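/- arXiv:math/0510074 — 12 statements merged into one kernel-verified Lean document; each statement's English description precedes it below -/
import Mathlib

section
/- Let $R$ be a commutative hereditary ring (every ideal of $R$ is projective as an $R$-module), let $S$ be a multiplicative subset of $R$, and let $E$ be an injective $R$-module. Then the localization $S^{-1}E$ is an injective $R$-module. -/
universe u v

section ProjectiveIdeal

variable {R : Type u} [CommRing R]

theorem LinearMap.map_mul_eq_of_ideal {I : Ideal R} (φ : I →ₗ[R] R) (a b : I) :
    φ a * (b : R) = φ b * (a : R) := by
  have h : (b : R) • a = (a : R) • b := Subtype.ext (mul_comm _ _)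
  simpa [mul_comm] using congrArg φ h

/-- A projective ideal is locally principal: at a prime `p`, either a given element of the ideal
vanishes locally, or the whole ideal is locally generated by one element. -/
theorem Ideal.exists_mul_eq_zero_or_locally_principal {I : Ideal R} (hI : Module.Projective R I)
    (p : Ideal R) [hp : p.IsPrime] {a : R} (ha : a ∈ I) :
    (∃ s ∉ p, s * a = 0) ∨ ∃ c ∈ I, ∃ s ∉ p, ∀ b ∈ I, ∃ r, s * b = c * r := by
  obtain ⟨σ, hσ⟩ := Module.projective_def.mp hI
  by_cases h : ∃ i : I, σ i i ∉ p
  · obtain ⟨i, hi⟩ := h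
    refine .inr ⟨i, i.2, σ i i, hi, fun b hb ↦ ⟨σ ⟨b, hb⟩ i, ?_⟩⟩
    rw [mul_comm (i : R)]
    exact LinearMap.map_mul_eq_of_ideal (Finsupp.lapply i ∘ₗ σ) i ⟨b, hb⟩
  · push Not at h
    set t := (σ ⟨a, ha⟩).support
    have hsum : ∑ i ∈ t, σ i i ∈ p := p.sum_mem fun i _ ↦ h i
    refine .inl ⟨1 - ∑ i ∈ t, σ i i, fun h1 ↦ hp.ne_top <| (Ideal.eq_top_iff_one p).mpr ?_, ?_⟩
    · simpa using add_mem h1 hsum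
    · have key : a = ∑ i ∈ t, σ ⟨a, ha⟩ i * (i : R) := by
        simpa [Finsupp.linearCombination_apply, Finsupp.sum, t] using
          (congrArg (Subtype.val : I → R) (hσ ⟨a, ha⟩)).symm
      rw [sub_mul, one_mul, Finset.sum_mul, sub_eq_zero]
      conv_lhs => rw [key]
      exact Finset.sum_congr rfl fun i _ ↦
        LinearMap.map_mul_eq_of_ideal (Finsupp.lapply i ∘ₗ σ) ⟨a, ha⟩ i

/-- The annihilator of an element generating a projective ideal is generated by an idempotent. -/
theorem Ideal.exists_annihilator_idempotent_of_projective_span {s : R}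
    (h : Module.Projective R (Ideal.span {s})) :
    ∃ e : R, s * e = 0 ∧ ∀ r, s * r = 0 → e * r = r := by
  let s' : Ideal.span {s} := ⟨s, Ideal.mem_span_singleton_self s⟩
  let g : R →ₗ[R] Ideal.span {s} := LinearMap.toSpanSingleton R _ s'
  have hg : Function.Surjective g := by
    rintro ⟨x, hx⟩
    obtain ⟨r, rfl⟩ := Ideal.mem_span_singleton'.mp hx
    exact ⟨r, rfl⟩
  obtain ⟨k, hk⟩ := Module.projective_lifting_property g LinearMap.id hg
  have h1 : k s' * s = s := congrArg Subtype.val (LinearMap.congr_fun hk s')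
  refine ⟨1 - k s', by linear_combination -h1, fun r hr ↦ ?_⟩
  have h2 : r • s' = 0 := Subtype.ext ((mul_comm r s).trans hr)
  have h3 : r * k s' = 0 := by simpa using congrArg k h2
  linear_combination -h3

end ProjectiveIdeal

section MaximalPowers

variable {R : Type u} [CommRing R] (p : Ideal R) [p.IsMaximal]

theorem Ideal.IsMaximal.exists_mul_add_eq_one_of_notMem {s : R} (hs : s ∉ p) (n : ℕ) :
    ∃ a, ∃ b ∈ p ^ n, a * s + b = 1 := by
  have hmax : p.IsMaximal := inferInstance
  have h : Ideal.span {s} ⊔ p = ⊤ := by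
    obtain ⟨y, hy⟩ := hmax.exists_inv hs
    obtain ⟨i, hi, h1⟩ := hy
    rw [Ideal.eq_top_iff_one, ← h1]
    exact add_mem (Ideal.mul_mem_left _ _ (Ideal.mem_sup_left (Ideal.mem_span_singleton_self s)))
      (Ideal.mem_sup_right hi)
  have h' : Ideal.span {s} ⊔ p ^ n = ⊤ := Ideal.sup_pow_eq_top h
  obtain ⟨x, hx, b, hb, hxb⟩ := Submodule.mem_sup.mp ((Ideal.eq_top_iff_one _).mp h')
  obtain ⟨a, rfl⟩ := Ideal.mem_span_singleton'.mp hx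
  exact ⟨a, b, hb, hxb⟩

theorem Ideal.IsMaximal.mem_pow_of_mul_mem {s y : R} (hs : s ∉ p) {n : ℕ} (h : s * y ∈ p ^ n) :
    y ∈ p ^ n := by
  obtain ⟨a, b, hb, hab⟩ := exists_mul_add_eq_one_of_notMem p hs n
  have : y = a * (s * y) + b * y := by linear_combination -y * hab
  rw [this]
  exact add_mem (Ideal.mul_mem_left _ _ h) (Ideal.mul_mem_right _ _ hb)

theorem Ideal.IsMaximal.exists_pow_le_span_sup (n : ℕ)
    (hn : Module.Projective R (p ^ n : Ideal R)) :
    ∃ c ∈ p ^ n, ∀ a ∈ p ^ n, ∃ r, a - c * r ∈ p ^ (n + 1) := by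
  have hmul {s : R} (hs : s ∉ p) : ∃ u, ∀ a ∈ p ^ n, a - u * (s * a) ∈ p ^ (n + 1) := by
    obtain ⟨u, b, hb, hub⟩ := exists_mul_add_eq_one_of_notMem p hs 1
    refine ⟨u, fun a ha ↦ ?_⟩
    have : a - u * (s * a) = a * b := by linear_combination -a * hub
    rw [this, pow_succ]
    exact Ideal.mul_mem_mul ha (by simpa using hb)
  by_cases h : ∃ c ∈ p ^ n, ∃ s ∉ p, ∀ b ∈ p ^ n, ∃ r, s * b = c * r
  · obtain ⟨c, hc, s, hs, H⟩ := h
    obtain ⟨u, hu⟩ := hmul hs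
    refine ⟨c, hc, fun a ha ↦ ?_⟩
    obtain ⟨r, hr⟩ := H a ha
    refine ⟨u * r, ?_⟩
    have := hu a ha
    rwa [hr, mul_left_comm] at this
  · refine ⟨0, zero_mem _, fun a ha ↦ ⟨0, ?_⟩⟩
    obtain ⟨s, hs, hsa⟩ := (Ideal.exists_mul_eq_zero_or_locally_principal hn p ha).resolve_right h
    obtain ⟨u, hu⟩ := hmul hs
    simpa [hsa] using hu a ha

theorem Ideal.IsMaximal.small_quotient_pow (hR : ∀ I : Ideal R, Module.Projective R I)
    [Small.{v} (R ⧸ p)] (n : ℕ) : Small.{v} (R ⧸ p ^ n) := by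
  induction n with
  | zero =>
    have : Subsingleton (R ⧸ p ^ 0) := by
      rw [pow_zero, Ideal.one_eq_top]
      infer_instance
    infer_instance
  | succ n ih =>
    obtain ⟨c, hc, H⟩ := exists_pow_le_span_sup p n (hR _)
    refine small_of_surjective (α := (R ⧸ p ^ n) × (R ⧸ p))
      (f := fun x ↦ Ideal.Quotient.mk _ (x.1.out + c * x.2.out)) fun y ↦ ?_
    obtain ⟨y, rfl⟩ := Ideal.Quotient.mk_surjective y
    have hout (I : Ideal R) (z : R) : z - (Ideal.Quotient.mk I z).out ∈ I :=
      Ideal.Quotient.eq.mp (Quotient.out_eq' (Ideal.Quotient.mk I z)).symm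
    obtain ⟨r, hr⟩ := H _ (hout (p ^ n) y)
    refine ⟨(Ideal.Quotient.mk _ y, Ideal.Quotient.mk _ r), (Ideal.Quotient.eq.mpr ?_).symm⟩
    have h2 : c * (r - (Ideal.Quotient.mk p r).out) ∈ p ^ (n + 1) := by
      rw [pow_succ]
      exact Ideal.mul_mem_mul hc (hout p r)
    convert add_mem hr h2 using 1
    ring

/-- Krull's intersection theorem at a maximal ideal of a hereditary ring. -/
theorem Ideal.IsMaximal.exists_mul_eq_zero_of_forall_mem_pow
    (hR : ∀ I : Ideal R, Module.Projective R I) {x : R} (hx : ∀ n : ℕ, x ∈ p ^ n) :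
    ∃ s ∉ p, s * x = 0 := by
  have hp : p.IsPrime := Ideal.IsMaximal.isPrime inferInstance
  have hmul {s t : R} (hs : s ∉ p) (ht : t ∉ p) : s * t ∉ p := fun h ↦
    (hp.mem_or_mem h).elim hs ht
  have hxp : x ∈ p := by simpa using hx 1
  rcases Ideal.exists_mul_eq_zero_or_locally_principal (hR p) p hxp with h | ⟨c, hc, s, hs, H⟩
  · exact h
  obtain ⟨e, hce, he⟩ := Ideal.exists_annihilator_idempotent_of_projective_span (hR (Ideal.span {c}))
  by_cases hep : e ∈ p
  swap
  · obtain ⟨r, hr⟩ := H x hxp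
    exact ⟨e * s, hmul hep hs, by linear_combination e * hr + r * hce⟩
  have hep' : 1 - e ∉ p := fun h ↦ hp.ne_top <| (Ideal.eq_top_iff_one p).mpr <| by
    simpa using add_mem h hep
  have hpow (n : ℕ) : ∀ a ∈ p ^ n, ∃ r, s ^ n * a = c ^ n * r := by
    induction n with
    | zero => exact fun a _ ↦ ⟨a, by simp⟩
    | succ n ih =>
      intro a ha
      rw [pow_succ] at ha
      refine Submodule.mul_induction_on ha (fun a ha b hb ↦ ?_) fun a b ⟨q, hq⟩ ⟨r, hr⟩ ↦
        ⟨q + r, by linear_combination hq + hr⟩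
      obtain ⟨q, hq⟩ := ih a ha
      obtain ⟨r, hr⟩ := H b hb
      exact ⟨q * r, by linear_combination s * b * hq + c ^ n * q * hr⟩
  have hdiv {d y : R} (hd : ∀ n : ℕ, d ∈ p ^ n) (hy : s * d = c * y) (n : ℕ) : y ∈ p ^ n := by
    obtain ⟨z, hz⟩ := hpow (n + 1) d (hd _)
    have h0 : c * (s ^ n * y - c ^ n * z) = 0 := by linear_combination hz - s ^ n * hy
    have h1 := he _ h0
    have hsn : s ^ n ∉ p := fun h ↦ hs (hp.mem_of_pow_mem n h)
    refine mem_pow_of_mul_mem p (hmul hep' hsn) ?_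
    have : (1 - e) * s ^ n * y = c ^ n * ((1 - e) * z) := by linear_combination -h1
    rw [this]
    exact Ideal.mul_mem_right _ _ (Ideal.pow_mem_pow hc n)
  have hmem {y : R} : y ∈ (⨅ n : ℕ, p ^ n) ↔ ∀ n : ℕ, y ∈ p ^ n := Submodule.mem_iInf _
  rcases Ideal.exists_mul_eq_zero_or_locally_principal (hR (⨅ n : ℕ, p ^ n)) p (hmem.mpr hx) with
    h | ⟨d, hd, t, ht, H'⟩
  · exact h
  obtain ⟨y, hy⟩ := H d (by simpa using hmem.mp hd 1)
  obtain ⟨z, hz⟩ := H' y (hmem.mpr (hdiv (hmem.mp hd) hy))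
  obtain ⟨w, hw⟩ := H' x (hmem.mpr hx)
  have hts : t * s - c * z ∉ p := fun h ↦ hmul ht hs <| by
    simpa using add_mem h (Ideal.mul_mem_right z _ hc)
  refine ⟨(t * s - c * z) * t, hmul hts ht, ?_⟩
  linear_combination (t * s - c * z) * hw + w * t * hy + w * c * hz

end MaximalPowers

section Injective

variable {R : Type u} [CommRing R] {E : Type v} [AddCommGroup E] [Module R E]

theorem Module.small_quotient_annihilator : Small.{v} (R ⧸ Module.annihilator R E) := by
  let F : R →ₗ[R] Module.End R E := LinearMap.lsmul R E
  have hF : LinearMap.ker F = Module.annihilator R E := by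
    ext r
    simp [F, Module.mem_annihilator, LinearMap.ext_iff]
  rw [← hF]
  exact small_of_injective (LinearMap.ker_eq_bot.mp (Submodule.ker_liftQ_eq_bot' _ F rfl))

/-- Over a hereditary ring `R`, Baer's criterion holds for an `R`-module that is injective with
respect to the modules of its own universe, with no smallness assumption on `R`. -/
theorem Module.Injective.baer_of_hereditary (hR : ∀ I : Ideal R, Module.Projective R I)
    (hE : Module.Injective R E) : Module.Baer R E := by
  intro J f
  let A := Module.annihilator R E
  have hA : Small.{v} (R ⧸ A) := Module.small_quotient_annihilator
  let P := {p : Ideal R // p.IsMaximal ∧ A ≤ p}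
  have hP : Small.{v} P := by
    refine small_of_injective (β := Set (R ⧸ A))
      (f := fun p ↦ (Ideal.Quotient.mk A) '' (p.1 : Set R)) ?_
    have hle (p q : P)
        (h : (Ideal.Quotient.mk A) '' (p.1 : Set R) ⊆ (Ideal.Quotient.mk A) '' (q.1 : Set R)) :
        p.1 ≤ q.1 := by
      intro x hx
      obtain ⟨y, hy, hxy⟩ := h ⟨x, hx, rfl⟩
      have hmem := q.2.2 (Ideal.Quotient.eq.mp hxy)
      simpa using sub_mem (show y ∈ q.1 from hy) hmem
    exact fun p q h ↦ Subtype.ext (le_antisymm (hle p q h.subset) (hle q p h.symm.subset))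
  have hsmall (p : P) (n : ℕ) : Small.{v} (R ⧸ p.1 ^ n) := by
    have := p.2.1
    have : Small.{v} (R ⧸ p.1) := small_of_surjective (Ideal.Quotient.factor_surjective p.2.2)
    exact Ideal.IsMaximal.small_quotient_pow p.1 hR n
  let F : R →ₗ[R] (Π (p : P) (n : ℕ), R ⧸ p.1 ^ n) :=
    LinearMap.pi fun p ↦ LinearMap.pi fun n ↦ (p.1 ^ n).mkQ
  have hF {x : R} (hx : F x = 0) (p : P) (n : ℕ) : x ∈ p.1 ^ n :=
    (Submodule.Quotient.mk_eq_zero _).mp (congrFun (congrFun hx p) n)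
  let N := LinearMap.ker F
  have hN : Small.{v} (R ⧸ N) :=
    small_of_injective (LinearMap.ker_eq_bot.mp (Submodule.ker_liftQ_eq_bot' _ F rfl))
  let q : J →ₗ[R] R ⧸ N := N.mkQ ∘ₗ J.subtype
  have hqf : LinearMap.ker q ≤ LinearMap.ker f := by
    intro x hx
    have hxF : F x = 0 := (Submodule.Quotient.mk_eq_zero N).mp hx
    by_contra hfx
    have hne : LinearMap.ker (LinearMap.toSpanSingleton R E (f x)) ≠ ⊤ := fun h ↦
      hfx <| by simpa using (Ideal.eq_top_iff_one _).mp h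
    obtain ⟨p, hp, hle⟩ := Ideal.exists_le_maximal _ hne
    have hAp : A ≤ p := fun a ha ↦ hle <| by
      simpa using Module.mem_annihilator.mp ha (f x)
    obtain ⟨s, hs, hsx⟩ := Ideal.IsMaximal.exists_mul_eq_zero_of_forall_mem_pow p hR
      (hF hxF ⟨p, hp, hAp⟩)
    have hsx' : s • x = 0 := Subtype.ext hsx
    exact hs (hle (by simpa using congrArg f hsx'))
  let i : (J ⧸ LinearMap.ker q) →ₗ[R] R ⧸ N := (LinearMap.ker q).liftQ q le_rfl
  have hi : Function.Injective i :=
    LinearMap.ker_eq_bot.mp (Submodule.ker_liftQ_eq_bot' _ q rfl)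
  have hJ : Small.{v} (J ⧸ LinearMap.ker q) := small_of_injective hi
  let eX := Shrink.linearEquiv.{v} R (J ⧸ LinearMap.ker q)
  let eY := Shrink.linearEquiv.{v} R (R ⧸ N)
  obtain ⟨h, hh⟩ := hE.out (eY.symm.toLinearMap ∘ₗ i ∘ₗ eX.toLinearMap)
    (eY.symm.injective.comp (hi.comp eX.injective))
    ((LinearMap.ker q).liftQ f hqf ∘ₗ eX.toLinearMap)
  refine ⟨h ∘ₗ eY.symm.toLinearMap ∘ₗ N.mkQ, fun x hx ↦ ?_⟩
  simpa [i, q] using hh (eX.symm (Submodule.Quotient.mk ⟨x, hx⟩))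

theorem Module.Baer.of_surjective_of_hereditary {M : Type*} [AddCommGroup M] [Module R M]
    (hR : ∀ I : Ideal R, Module.Projective R I) (hE : Module.Baer R E) (π : E →ₗ[R] M)
    (hπ : Function.Surjective π) : Module.Baer R M := by
  intro I g
  have := hR I
  obtain ⟨k, hk⟩ := Module.projective_lifting_property π g hπ
  obtain ⟨h, hh⟩ := hE I k
  exact ⟨π ∘ₗ h, fun x hx ↦ by simp [hh x hx, ← hk]⟩

theorem LocalizedModule.mkLinearMap_surjective_of_hereditary
    (hR : ∀ I : Ideal R, Module.Projective R I) (hE : Module.Baer R E) (S : Submonoid R) :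
    Function.Surjective (LocalizedModule.mkLinearMap S E) := by
  intro z
  induction z using LocalizedModule.induction_on with | _ x s
  let I := Ideal.span {(s : R)}
  let s' : I := ⟨s, Ideal.mem_span_singleton_self _⟩
  let g : R →ₗ[R] I := LinearMap.toSpanSingleton R _ s'
  have hg : Function.Surjective g := by
    rintro ⟨x, hx⟩
    obtain ⟨r, rfl⟩ := Ideal.mem_span_singleton'.mp hx
    exact ⟨r, rfl⟩
  have := hR I
  obtain ⟨k, hk⟩ := Module.projective_lifting_property g LinearMap.id hg
  have h1 : k s' * s = s := congrArg Subtype.val (LinearMap.congr_fun hk s')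
  obtain ⟨h, hh⟩ := hE I (LinearMap.toSpanSingleton R E x ∘ₗ k)
  refine ⟨h 1, ?_⟩
  have h2 : (s : R) • h 1 = k s' • x := by
    rw [← map_smul, smul_eq_mul, mul_one]
    exact hh s s'.2
  rw [LocalizedModule.mkLinearMap_apply, LocalizedModule.mk_eq]
  refine ⟨s, ?_⟩
  simp only [Submonoid.smul_def, one_smul, h2, smul_smul]
  rw [mul_comm, h1]

end Injective

/-- Let `R` be a commutative hereditary ring (every ideal of `R` is projective
as an `R`-module), let `S` be a multiplicative subset of `R`, and let `E` be an injective
`R`-module.  Then the localization `S⁻¹E` is an injective `R`-module. -/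
theorem localizedModule_injective_of_hereditary {R : Type*} [CommRing R]
    (hR : ∀ I : Ideal R, Module.Projective R I)
    (S : Submonoid R) {E : Type*} [AddCommGroup E] [Module R E]
    (hE : Module.Injective R E) :
    Module.Injective R (LocalizedModule S E) :=
  have hB := hE.baer_of_hereditary hR
  (hB.of_surjective_of_hereditary hR _
    (LocalizedModule.mkLinearMap_surjective_of_hereditary hR hB S)).injective
end

section
/- Let $R$ be a commutative hereditary ring and let $s \in R$. Then the annihilator $(0 : s) = \{r \in R \mid rs = 0\}$ is generated by an idempotent $e$ of $R$, and $s + e$ is a non-zerodivisor of $R$. -/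
/-- If the cyclic module generated by `m` is projective, then the annihilator of `m` is generated
by an idempotent: there is `e` annihilating `m` that fixes every `r` annihilating `m`. -/
theorem Module.Projective.exists_smul_eq_zero_and_forall_mul_eq {R M : Type*} [CommRing R]
    [AddCommGroup M] [Module R M] (m : M) [Module.Projective R (Submodule.span R {m})] :
    ∃ e : R, e • m = 0 ∧ ∀ r : R, r • m = 0 → r * e = r := by
  let x : Submodule.span R {m} := ⟨m, Submodule.mem_span_singleton_self m⟩
  have hsurj : Function.Surjective (LinearMap.toSpanSingleton R (Submodule.span R {m}) x) := by
    rintro ⟨y, hy⟩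
    obtain ⟨r, rfl⟩ := Submodule.mem_span_singleton.mp hy
    exact ⟨r, rfl⟩
  obtain ⟨g, hg⟩ := Module.projective_lifting_property _ LinearMap.id hsurj
  have hgm : g x • m = m := congrArg Subtype.val (LinearMap.congr_fun hg x)
  refine ⟨1 - g x, by rw [sub_smul, one_smul, hgm, sub_self], fun r hr => ?_⟩
  have hrx : r • x = 0 := Subtype.ext hr
  have hrg : r * g x = 0 := by rw [← smul_eq_mul, ← map_smul, hrx, map_zero]
  rw [mul_sub, mul_one, hrg, sub_zero]

/-- Let `R` be a commutative hereditary ring and `s ∈ R`.  Then the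
annihilator `(0 : s) = {r ∈ R | r * s = 0}` is generated by an idempotent `e` of `R`, and
`s + e` is a non-zerodivisor of `R`. -/
theorem annihilator_span_idempotent_of_hereditary {R : Type*} [CommRing R]
    (hR : ∀ I : Ideal R, Module.Projective R I) (s : R) :
    ∃ e : R, IsIdempotentElem e ∧ {r : R | r * s = 0} = (Ideal.span {e} : Ideal R) ∧
      s + e ∈ nonZeroDivisors R := by
  have : Module.Projective R (Submodule.span R {s}) := hR (Ideal.span {s})
  obtain ⟨e, hes, he⟩ := Module.Projective.exists_smul_eq_zero_and_forall_mul_eq (R := R) s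
  simp only [smul_eq_mul] at hes he
  have hidem : e * e = e := he e hes
  refine ⟨e, hidem, ?_, mem_nonZeroDivisors_iff_right.mpr fun r hr => ?_⟩
  · ext r
    simp only [Set.mem_ofPred_eq, SetLike.mem_coe, Ideal.mem_span_singleton']
    refine ⟨fun hr => ⟨r, he r hr⟩, ?_⟩
    rintro ⟨a, rfl⟩
    rw [mul_assoc, hes, mul_zero]
  · have hre : r * e = 0 := by linear_combination e * hr - r * hes - r * hidem
    have hrs : r * s = 0 := by linear_combination hr - hre
    rw [← he r hrs, hre]
end

section
/- Let $R$ be a valuation ring, let $Z$ be the set of zerodivisors of $R$, and let $E$ be an fp-injective $R$-module, i.e. $(0 : r) \subseteq (0 : x)$ implies $x \in rE$ for all $r \in R$, $x \in E$. Then for every prime ideal $J$ of $R$ with $J \neq Z$, the localization $E_J$ is an fp-injective $R$-module. -/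
theorem LocalizedModule.smul_mk_eq_zero_iff {R E : Type*} [CommRing R] [AddCommGroup E]
    [Module R E] {S : Submonoid R} {t : R} {e : E} {s : S} :
    t • LocalizedModule.mk e s = 0 ↔ ∃ u ∈ S, (u * t) • e = 0 := by
  rw [LocalizedModule.smul'_mk, ← LocalizedModule.zero_mk s, LocalizedModule.mk_eq]
  constructor
  · rintro ⟨u, hu⟩
    refine ⟨u * s, S.mul_mem u.2 s.2, ?_⟩
    simpa [Submonoid.smul_def, mul_smul] using hu
  · rintro ⟨u, huS, hu⟩
    refine ⟨⟨u, huS⟩, ?_⟩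
    simp only [smul_zero, Submonoid.smul_def]
    rw [smul_comm u, ← mul_smul u t, hu, smul_zero]

theorem LocalizedModule.exists_mk_eq_smul {R E : Type*} [CommRing R] [AddCommGroup E]
    [Module R E] {S : Submonoid R} {r v : R} (hv : v ∈ S) {e y : E} (h : v • e = r • y) (s : S) :
    ∃ x : LocalizedModule S E, LocalizedModule.mk e s = r • x := by
  refine ⟨LocalizedModule.mk y (⟨v, hv⟩ * s), ?_⟩
  rw [LocalizedModule.smul'_mk, ← h]
  exact (LocalizedModule.mk_cancel_common_left ⟨v, hv⟩ s e).symm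

/-- If `(0 : r)` annihilates `e` locally at `J`, then it annihilates a multiple `v • e` for
a single `v` outside `J`, provided that `J` is not the ideal of zerodivisors. -/
theorem exists_uniform_annihilator_of_ne_zeroDivisors {R : Type*} [CommRing R]
    (hchain : ∀ a b : R, ∃ c : R, a * c = b ∨ b * c = a)
    (Z : Ideal R) (hZ : ∀ r : R, r ∈ Z ↔ ∃ s : R, s ≠ 0 ∧ r * s = 0)
    {E : Type*} [AddCommGroup E] [Module R E]
    (J : Ideal R) [hJ : J.IsPrime] (hJZ : J ≠ Z) (r : R) (e : E)
    (h : ∀ t : R, t * r = 0 → ∃ u ∈ J.primeCompl, (u * t) • e = 0) :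
    ∃ v ∈ J.primeCompl, ∀ t : R, t * r = 0 → t • v • e = 0 := by
  by_cases hr : ∃ u ∈ J.primeCompl, u * r = 0
  · obtain ⟨u, hu, hur⟩ := hr
    obtain ⟨w, hw, hwu⟩ := h u hur
    exact ⟨w * u, J.primeCompl.mul_mem hw hu, fun t _ => by rw [hwu, smul_zero]⟩
  push Not at hr
  by_cases hle : J ≤ Z
  · obtain ⟨z, hzZ, hzJ⟩ := SetLike.exists_of_lt (lt_of_le_of_ne hle hJZ)
    obtain ⟨s, hs, hzs⟩ := (hZ z).1 hzZ
    obtain ⟨c, rfl | rfl⟩ := hchain r s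
    · obtain ⟨u, hu, hue⟩ := h (z * c) (by linear_combination hzs)
      refine ⟨u * z, J.primeCompl.mul_mem hu hzJ, fun t ht => ?_⟩
      obtain ⟨d, rfl | rfl⟩ := hchain c t
      · have key : c * d * (u * z) = d * (u * (z * c)) := by ring
        rw [← mul_smul, key, mul_smul, hue, smul_zero]
      · exact absurd (by linear_combination d * ht) hs
    · exact absurd (by linear_combination c * hzs) (hr z hzJ)
  · obtain ⟨p, hpJ, hpZ⟩ := SetLike.not_le_iff_exists.1 hle
    have hp : ∀ a, p * a = 0 → a = 0 := fun a ha => by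
      by_contra h0
      exact hpZ ((hZ p).2 ⟨a, h0, ha⟩)
    refine ⟨1, J.primeCompl.one_mem, fun t ht => ?_⟩
    rw [one_smul]
    obtain ⟨c, rfl | rfl⟩ := hchain p t
    · obtain ⟨u, hu, hue⟩ := h c (hp _ (by linear_combination ht))
      obtain ⟨d, rfl | rfl⟩ := hchain u p
      · have key : u * d * c = d * (u * c) := by ring
        rw [key, mul_smul, hue, smul_zero]
      · exact absurd (J.mul_mem_right d hpJ) hu
    · have hr0 : r = 0 := hp r (by linear_combination c * ht)
      exact absurd (by simp [hr0]) (hr 1 J.primeCompl.one_mem)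


/-- Let `R` be a valuation ring, `Z` its (prime) ideal of zerodivisors and
`E` an fp-injective (equivalently divisible) `R`-module: `(0 : r) ⊆ (0 : x)` implies `x ∈ rE`.
Then for every prime ideal `J ≠ Z` the localization `E_J` is fp-injective. -/
theorem localizedModule_fpInjective_of_valuationRing {R : Type*} [CommRing R]
    (hchain : ∀ a b : R, ∃ c : R, a * c = b ∨ b * c = a)
    (Z : Ideal R) (hZ : ∀ r : R, r ∈ Z ↔ ∃ s : R, s ≠ 0 ∧ r * s = 0)
    {E : Type*} [AddCommGroup E] [Module R E]
    (hE : ∀ (r : R) (x : E), (∀ t : R, t * r = 0 → t • x = 0) → ∃ y : E, x = r • y)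
    (J : Ideal R) (hJ : J.IsPrime) (hJZ : J ≠ Z) :
    ∀ (r : R) (x : LocalizedModule J.primeCompl E),
      (∀ t : R, t * r = 0 → t • x = 0) → ∃ y : LocalizedModule J.primeCompl E, x = r • y := by
  intro r x
  induction x using LocalizedModule.induction_on with
  | h e s =>
    intro hx
    obtain ⟨v, hv, hve⟩ := exists_uniform_annihilator_of_ne_zeroDivisors hchain Z hZ J hJZ r e
      fun t ht => LocalizedModule.smul_mk_eq_zero_iff.1 (hx t ht)
    obtain ⟨y, hy⟩ := hE r (v • e) hve
    exact LocalizedModule.exists_mk_eq_smul hv hy s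
end

section
/- Let $R$ be a valuation ring, let $Z$ be the set of zerodivisors of $R$, and let $E$ be an fp-injective $R$-module. If $E$ is a flat $R$-module or $Z$ is a flat $R$-module, then the localization $E_Z$ is an fp-injective $R$-module. -/
/-- In a ring whose principal ideals form a chain, a zerodivisor is a multiple of every
non-zerodivisor. -/
theorem dvd_of_mem_nonZeroDivisors_of_notMem {R : Type*} [CommRing R]
    (hchain : ∀ a b : R, ∃ c : R, a * c = b ∨ b * c = a) {u z : R}
    (hu : u ∈ nonZeroDivisors R) (hz : z ∉ nonZeroDivisors R) : u ∣ z := by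
  obtain ⟨c, hc | hc⟩ := hchain u z
  · exact ⟨c, hc.symm⟩
  · exact absurd (mul_mem_nonZeroDivisors.mp (hc ▸ hu)).1 hz

/-- If the ideal `Z` of zerodivisors is flat and its elements are multiples of all
non-zerodivisors, then an element of a module whose image in the localization at the
non-zerodivisors is annihilated by `(0 : r)`, with `r ≠ 0`, is itself annihilated by `(0 : r)`. -/
theorem smul_eq_zero_of_flat_zeroDivisors {R : Type*} [CommRing R]
    {Z : Ideal R} [Module.Flat R Z] (hZ : ∀ s : R, s ≠ 0 → ∀ t : R, t * s = 0 → t ∈ Z)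
    (hdvd : ∀ u ∈ nonZeroDivisors R, ∀ z ∈ Z, u ∣ z)
    {E : Type*} [AddCommGroup E] [Module R E] {r : R} (hr : r ≠ 0) {e : E}
    (he : ∀ t : R, t * r = 0 → ∃ u ∈ nonZeroDivisors R, u • t • e = 0)
    {t : R} (ht : t * r = 0) : t • e = 0 := by
  have hrel : ∑ i : Unit, (fun _ => r) i • (fun _ => (⟨t, hZ r hr t ht⟩ : Z)) i = 0 := by
    simpa [Subtype.ext_iff, mul_comm] using ht
  obtain ⟨n, a, y, hy, ha⟩ := Module.Flat.isTrivialRelation_of_sum_smul_eq_zero hrel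
  have hty : t = ∑ j, a () j * (y j : R) := by
    simpa using congrArg (Subtype.val : Z → R) (hy ())
  rw [hty, Finset.sum_smul]
  refine Finset.sum_eq_zero fun j _ => ?_
  obtain ⟨u, hu, hue⟩ := he (a () j) (by simpa [mul_comm] using ha j)
  obtain ⟨c, hc⟩ := hdvd u hu _ (y j).2
  rw [hc, show a () j * (u * c) = c * (u * a () j) by ring, mul_smul, mul_smul, hue, smul_zero]

/-- Let `R` be a valuation ring, `Z` its (prime) ideal of zerodivisors and
`E` an fp-injective (divisible) `R`-module.  If `E` is flat or `Z` is flat, then `E_Z` (the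
localization of `E` at the multiplicative set `R ∖ Z`, i.e. at the non-zerodivisors of `R`)
is fp-injective. -/
theorem localizedModule_at_zerodivisors_fpInjective {R : Type*} [CommRing R]
    (hchain : ∀ a b : R, ∃ c : R, a * c = b ∨ b * c = a)
    (Z : Ideal R) (hZ : ∀ r : R, r ∈ Z ↔ ∃ s : R, s ≠ 0 ∧ r * s = 0)
    {E : Type*} [AddCommGroup E] [Module R E]
    (hE : ∀ (r : R) (x : E), (∀ t : R, t * r = 0 → t • x = 0) → ∃ y : E, x = r • y)
    (hflat : Module.Flat R E ∨ Module.Flat R Z) :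
    ∀ (r : R) (x : LocalizedModule (nonZeroDivisors R) E),
      (∀ t : R, t * r = 0 → t • x = 0) →
        ∃ y : LocalizedModule (nonZeroDivisors R) E, x = r • y := by
  intro r x hx
  by_cases hr : r = 0
  · exact ⟨0, by simpa using hx 1 (by simp [hr])⟩
  induction x using LocalizedModule.induction_on with
  | h e s =>
  have he : ∀ t : R, t * r = 0 → ∃ u ∈ nonZeroDivisors R, u • t • e = 0 := by
    intro t ht
    have h := hx t ht
    rw [LocalizedModule.smul'_mk, ← LocalizedModule.zero_mk s,
      LocalizedModule.mk_eq] at h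
    obtain ⟨u, hu⟩ := h
    refine ⟨u * s, mul_mem u.2 s.2, ?_⟩
    rw [mul_smul]
    simpa only [smul_zero, Submonoid.smul_def] using hu
  suffices h : ∀ t : R, t * r = 0 → t • e = 0 by
    obtain ⟨y, rfl⟩ := hE r e h
    exact ⟨LocalizedModule.mk y s, (LocalizedModule.smul'_mk r y s).symm⟩
  intro t ht
  rcases hflat with hflat | hflat
  · obtain ⟨u, hu, hue⟩ := he t ht
    have hreg : IsSMulRegular E u := Module.Flat.isSMulRegular_of_nonZeroDivisors hu
    exact hreg (by simpa using hue)
  · refine smul_eq_zero_of_flat_zeroDivisors (Z := Z)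
      (fun s hs t hts => (hZ t).mpr ⟨s, hs, hts⟩) (fun u hu z hz => ?_) hr he ht
    refine dvd_of_mem_nonZeroDivisors_of_notMem hchain hu fun hz' => ?_
    obtain ⟨s, hs, hzs⟩ := (hZ z).mp hz
    exact hs ((mul_left_mem_nonZeroDivisors_eq_zero_iff hz').mp hzs)
end

section
/- Let $R$ be a valuation ring with maximal ideal $P$, let $E$ be an injective $R$-module, and let $r \in P$, $r \neq 0$. Then $E/rE$ is an injective module over the quotient ring $R/rR$. -/
/-- The equation `r • z = y` is solvable in a Baer module as soon as `y` is killed by the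
annihilator of `r`. -/
lemma Module.Baer.exists_smul_eq {R E : Type*} [CommRing R] [AddCommGroup E] [Module R E]
    (hE : Module.Baer R E) {r : R} {y : E} (h : ∀ c : R, c * r = 0 → c • y = 0) :
    ∃ z : E, r • z = y := by
  let p : R →ₗ.[R] E := LinearPMap.mkSpanSingleton' r y h
  obtain ⟨g, hg⟩ := hE p.domain p.toFun
  refine ⟨g 1, ?_⟩
  have hr : r ∈ p.domain := Submodule.mem_span_singleton_self r
  rw [← map_smul, smul_eq_mul, mul_one, hg r hr]
  exact LinearPMap.mkSpanSingleton'_apply_self r y h hr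

/-- A linear map to `E / rE` from an ideal containing `r` which vanishes at `r` is
multiplication by an element of `E / rE`. -/
lemma Module.Baer.exists_forall_eq_smul_of_map_eq_zero {R E N : Type*} [CommRing R]
    (hchain : ∀ a b : R, ∃ c : R, a * c = b ∨ b * c = a)
    [AddCommGroup E] [Module R E] [AddCommGroup N] [Module R N] (hE : Module.Baer R E)
    {r : R} (hr0 : r ≠ 0) (π : E →ₗ[R] N) (hπ : Function.Surjective π)
    (hker : ∀ x, π x = 0 ↔ ∃ y, r • y = x)
    {J : Ideal R} (hrJ : r ∈ J) (f : J →ₗ[R] N) (hfr : f ⟨r, hrJ⟩ = 0) :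
    ∃ n : N, ∀ j : J, f j = (j : R) • n := by
  have kill : ∀ {a : R} {x : E}, a * r = 0 → π x = 0 → a • x = 0 := by
    intro a x ha hx
    obtain ⟨y, rfl⟩ := (hker x).1 hx
    rw [smul_smul, ha, zero_smul]
  -- The set of pairs `(j * a, a • x)`, with `a` annihilating `r` and `x` lifting `f j`,
  -- is the graph of a linear map.
  let S : Set (R × E) := {p | ∃ (j : J) (a : R) (x : E), a * r = 0 ∧ π x = f j ∧
    p = ((j : R) * a, a • x)}
  have hadd : ∀ (j j' : J) (a a' c : R) (x x' : E), a * r = 0 → a' * r = 0 → π x = f j →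
      π x' = f j' → (j : R) * c = j' →
      ((j : R) * a, a • x) + ((j' : R) * a', a' • x') ∈ S := by
    intro j j' a a' c x x' ha ha' hx hx' hc
    refine ⟨j, a + c * a', x, by linear_combination ha + c * ha', hx, ?_⟩
    have hj : j' = c • j := Subtype.ext (by simp [← hc, mul_comm])
    have h0 : a' • (x' - c • x) = 0 := kill ha' (by rw [map_sub, map_smul, hx, hx', hj]; simp)
    rw [smul_sub, sub_eq_zero, smul_smul] at h0
    ext
    · simp only [Prod.mk_add_mk]
      rw [← hc]; ring
    · simp only [Prod.mk_add_mk, h0, add_smul, mul_comm c]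
  let G : Submodule R (R × E) :=
    { carrier := S
      zero_mem' := ⟨0, 0, 0, by simp, by simp, by simp [Prod.zero_eq_mk]⟩
      add_mem' := by
        rintro _ _ ⟨j, a, x, ha, hx, rfl⟩ ⟨j', a', x', ha', hx', rfl⟩
        obtain ⟨c, hc | hc⟩ := hchain j j'
        · exact hadd j j' a a' c x x' ha ha' hx hx' hc
        · rw [add_comm]
          exact hadd j' j a' a c x' x ha' ha hx' hx hc
      smul_mem' := by
        rintro d _ ⟨j, a, x, ha, hx, rfl⟩
        refine ⟨j, d * a, x, by rw [mul_assoc, ha, mul_zero], hx, ?_⟩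
        simp [mul_smul, mul_left_comm] }
  have hG : ∀ p ∈ G, p.1 = 0 → p.2 = 0 := by
    rintro _ ⟨j, a, x, ha, hx, rfl⟩ (h0 : (j : R) * a = 0)
    change a • x = 0
    obtain ⟨t, ht | ht⟩ := hchain j r
    · have htx : π (t • x) = 0 := by
        rw [map_smul, hx, ← map_smul, ← hfr]
        exact congrArg f (Subtype.ext (by simp [← ht, mul_comm]))
      obtain ⟨b, hb | hb⟩ := hchain t a
      · rw [← hb, mul_comm, mul_smul]
        refine kill ?_ htx
        rw [← ht, ← h0, ← hb]; ring
      · refine absurd ?_ hr0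
        rw [← ht, ← hb, ← mul_assoc, h0, zero_mul]
    · refine kill ha ?_
      have hj : j = t • ⟨r, hrJ⟩ := Subtype.ext (by simp [← ht, mul_comm])
      rw [hx, hj, map_smul, hfr, smul_zero]
  obtain ⟨g, hg⟩ := hE G.toLinearPMap.domain G.toLinearPMap.toFun
  refine ⟨π (g 1), fun j ↦ ?_⟩
  obtain ⟨x, hx⟩ := hπ (f j)
  have hz : ∃ z, r • z = x - (j : R) • g 1 := by
    refine hE.exists_smul_eq fun a ha ↦ ?_
    have hmem : ((j : R) * a, a • x) ∈ G := ⟨j, a, x, ha, hx, rfl⟩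
    rw [← Submodule.toLinearPMap_graph_eq G hG, LinearPMap.mem_graph_iff] at hmem
    obtain ⟨y, hy1, hy2⟩ := hmem
    have hgy : g y = G.toLinearPMap y := hg y y.2
    rw [hy1, hy2] at hgy
    change g ((j : R) * a) = a • x at hgy
    rw [smul_sub, ← hgy, smul_smul, ← map_smul, smul_eq_mul, mul_one, mul_comm, sub_self]
  rw [← hker, map_sub, sub_eq_zero, map_smul, hx] at hz
  exact hz

/-- Linear maps to `E / rE` extend along injective maps between modules killed by `r`. -/
lemma Module.Baer.exists_extension_of_isTorsionBy {R E N X Y : Type*} [CommRing R]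
    (hchain : ∀ a b : R, ∃ c : R, a * c = b ∨ b * c = a)
    [AddCommGroup E] [Module R E] [AddCommGroup N] [Module R N] (hE : Module.Baer R E)
    {r : R} (hr0 : r ≠ 0) (π : E →ₗ[R] N) (hπ : Function.Surjective π)
    (hker : ∀ x, π x = 0 ↔ ∃ y, r • y = x)
    [AddCommGroup X] [Module R X] [AddCommGroup Y] [Module R Y]
    (hY : Module.IsTorsionBy R Y r) (i : X →ₗ[R] Y) (hi : Function.Injective i)
    (f : X →ₗ[R] N) : ∃ h : Y →ₗ[R] N, ∀ x, h (i x) = f x := by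
  have hX : Module.IsTorsionBy R X r := fun x ↦ hi (by rw [map_smul, map_zero]; exact @hY (i x))
  have hN : Module.IsTorsionBy R N r := fun n ↦ by
    obtain ⟨x, rfl⟩ := hπ n
    rw [← map_smul]
    exact (hker _).2 ⟨x, rfl⟩
  let := hX.module
  let := hY.module
  let := hN.module
  have hs : Function.Surjective (algebraMap R (R ⧸ Ideal.span {r})) :=
    Ideal.Quotient.mk_surjective
  have : IsScalarTower R (R ⧸ Ideal.span {r}) X :=
    IsScalarTower.of_algebraMap_smul fun _ _ ↦ rfl
  have : IsScalarTower R (R ⧸ Ideal.span {r}) Y :=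
    IsScalarTower.of_algebraMap_smul fun _ _ ↦ rfl
  have : IsScalarTower R (R ⧸ Ideal.span {r}) N :=
    IsScalarTower.of_algebraMap_smul fun _ _ ↦ rfl
  have hB : Module.Baer (R ⧸ Ideal.span {r}) N := by
    intro I g
    let J : Ideal R := I.comap (algebraMap R (R ⧸ Ideal.span {r}))
    have hr : algebraMap R (R ⧸ Ideal.span {r}) r = 0 :=
      Ideal.Quotient.eq_zero_iff_mem.2 (Ideal.mem_span_singleton_self r)
    have hrJ : r ∈ J := by
      change algebraMap R (R ⧸ Ideal.span {r}) r ∈ I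
      rw [hr]
      exact I.zero_mem
    let k : J →ₗ[R] N :=
      { toFun := fun j ↦ g ⟨algebraMap R _ j, j.2⟩
        map_add' := fun a b ↦ by
          rw [← map_add]
          exact congrArg g (Subtype.ext (map_add _ _ _))
        map_smul' := fun a b ↦ by
          rw [RingHom.id_apply, ← algebraMap_smul (R ⧸ Ideal.span {r}) a (g _), ← map_smul]
          exact congrArg g (Subtype.ext (map_mul _ _ _)) }
    have hk : k ⟨r, hrJ⟩ = 0 := by
      rw [← map_zero g]
      exact congrArg g (Subtype.ext hr)
    obtain ⟨n, hn⟩ := hE.exists_forall_eq_smul_of_map_eq_zero hchain hr0 π hπ hker hrJ k hk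
    refine ⟨LinearMap.toSpanSingleton _ _ n, fun x hx ↦ ?_⟩
    obtain ⟨x, rfl⟩ := hs x
    rw [LinearMap.toSpanSingleton_apply, algebraMap_smul]
    exact (hn ⟨x, hx⟩).symm
  obtain ⟨h, hh⟩ := hB.extension_property (i.extendScalarsOfSurjective hs) hi
    (f.extendScalarsOfSurjective hs)
  exact ⟨h.restrictScalars R, fun x ↦ LinearMap.congr_fun hh x⟩

universe u v

/-- Over the quotient of `R` by the annihilator of a module in the universe of `E`, an injective
module satisfies Baer's criterion, whatever the universe of `R`. -/
lemma Module.Injective.baer_of_surjective_of_faithful {R S : Type*} {E M : Type v} [CommRing R]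
    [CommRing S] [Algebra R S] (hs : Function.Surjective (algebraMap R S))
    [AddCommGroup E] [Module R E] [Module S E] [IsScalarTower R S E] (hE : Module.Injective R E)
    [AddCommGroup M] [Module S M] [FaithfulSMul S M] : Module.Baer S E := by
  have : Small.{v} S := small_of_injective (β := M → M) (f := fun s m ↦ s • m)
    fun a b h ↦ FaithfulSMul.eq_of_smul_eq_smul (congrFun h)
  refine Module.Baer.of_injective ⟨fun X Y _ _ _ _ i hi f ↦ ?_⟩
  let := Module.compHom X (algebraMap R S)
  let := Module.compHom Y (algebraMap R S)
  have : IsScalarTower R S X := IsScalarTower.of_algebraMap_smul fun _ _ ↦ rfl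
  have : IsScalarTower R S Y := IsScalarTower.of_algebraMap_smul fun _ _ ↦ rfl
  obtain ⟨h, hh⟩ := hE.out (i.restrictScalars R) hi (f.restrictScalars R)
  exact ⟨h.extendScalarsOfSurjective hs, hh⟩

/-- Linear maps to `E / rE` extend along injective maps between modules killed by `r`, in the
universe of `E`. -/
lemma Module.Injective.exists_extension_of_isTorsionBy {R : Type u} {E N X Y : Type v} [CommRing R]
    (hchain : ∀ a b : R, ∃ c : R, a * c = b ∨ b * c = a)
    [AddCommGroup E] [Module R E] [AddCommGroup N] [Module R N] (hE : Module.Injective R E)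
    {r : R} (π : E →ₗ[R] N) (hπ : Function.Surjective π)
    (hker : ∀ x, π x = 0 ↔ ∃ y, r • y = x)
    [AddCommGroup X] [Module R X] [AddCommGroup Y] [Module R Y]
    (hY : Module.IsTorsionBy R Y r) (i : X →ₗ[R] Y) (hi : Function.Injective i)
    (f : X →ₗ[R] N) : ∃ h : Y →ₗ[R] N, ∀ x, h (i x) = f x := by
  by_cases hr : ∀ x : E, r • x = 0
  · have hinj : Function.Injective π := by
      refine (injective_iff_map_eq_zero π).2 fun x hx ↦ ?_
      obtain ⟨y, rfl⟩ := (hker x).1 hx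
      exact hr y
    let e := LinearEquiv.ofBijective π ⟨hinj, hπ⟩
    obtain ⟨h, hh⟩ := hE.out i hi (e.symm.toLinearMap ∘ₗ f)
    exact ⟨e.toLinearMap ∘ₗ h, fun x ↦ by simp [hh]⟩
  let K := Module.annihilator R (E × Y)
  have hK : ∀ k ∈ K, ∀ p : E × Y, k • p = 0 := fun k hk ↦ Module.mem_annihilator.1 hk
  have tE : Module.IsTorsionBySet R E K :=
    fun x k ↦ congrArg Prod.fst (hK k k.2 (x, 0))
  have tY : Module.IsTorsionBySet R Y K :=
    fun y k ↦ congrArg Prod.snd (hK k k.2 (0, y))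
  have tX : Module.IsTorsionBySet R X K :=
    fun x k ↦ hi (by rw [map_zero, map_smul]; exact @tY (i x) k)
  have tN : Module.IsTorsionBySet R N K := fun n k ↦ by
    obtain ⟨x, rfl⟩ := hπ n
    rw [← map_smul, @tE x k, map_zero]
  let := tE.module
  let := tY.module
  let := tX.module
  let := tN.module
  have hs : Function.Surjective (algebraMap R (R ⧸ K)) := Ideal.Quotient.mk_surjective
  have : IsScalarTower R (R ⧸ K) E := IsScalarTower.of_algebraMap_smul fun _ _ ↦ rfl
  have : IsScalarTower R (R ⧸ K) Y := IsScalarTower.of_algebraMap_smul fun _ _ ↦ rfl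
  have : IsScalarTower R (R ⧸ K) X := IsScalarTower.of_algebraMap_smul fun _ _ ↦ rfl
  have : IsScalarTower R (R ⧸ K) N := IsScalarTower.of_algebraMap_smul fun _ _ ↦ rfl
  have : FaithfulSMul (R ⧸ K) (E × Y) := ⟨fun {a b} hab ↦ by
    obtain ⟨a, rfl⟩ := hs a
    obtain ⟨b, rfl⟩ := hs b
    refine Ideal.Quotient.eq.2 (Module.mem_annihilator.2 fun p ↦ ?_)
    rw [sub_smul, sub_eq_zero]
    simpa only [algebraMap_smul] using hab p⟩
  have hB : Module.Baer (R ⧸ K) E := hE.baer_of_surjective_of_faithful hs (M := E × Y)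
  have hchain' : ∀ a b : R ⧸ K, ∃ c, a * c = b ∨ b * c = a := by
    intro a b
    obtain ⟨a, rfl⟩ := hs a
    obtain ⟨b, rfl⟩ := hs b
    obtain ⟨c, hc⟩ := hchain a b
    exact ⟨algebraMap R _ c, hc.imp (fun h ↦ by rw [← map_mul, h]) fun h ↦ by rw [← map_mul, h]⟩
  have hr0 : algebraMap R (R ⧸ K) r ≠ 0 := fun h ↦
    hr fun x ↦ by rw [← algebraMap_smul (R ⧸ K) r x, h, zero_smul]
  obtain ⟨h, hh⟩ := hB.exists_extension_of_isTorsionBy hchain' hr0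
    (π.extendScalarsOfSurjective hs) hπ (by simpa [algebraMap_smul] using hker)
    (fun y ↦ by rw [algebraMap_smul]; exact @hY y)
    (i.extendScalarsOfSurjective hs) hi (f.extendScalarsOfSurjective hs)
  exact ⟨h.restrictScalars R, hh⟩

/-- Let `R` be a valuation ring (a commutative local ring whose ideals are
totally ordered by inclusion) with maximal ideal `P`, let `E` be an injective `R`-module and
let `r ∈ P`, `r ≠ 0`.  Then `E/rE` is an injective module over the quotient ring `R/rR`. -/
theorem quotient_injective_over_quotient_of_valuationRing {R : Type*} [CommRing R]
    [IsLocalRing R] (hchain : ∀ a b : R, ∃ c : R, a * c = b ∨ b * c = a)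
    {E : Type*} [AddCommGroup E] [Module R E] (hE : Module.Injective R E)
    (r : R) (hr : r ∈ IsLocalRing.maximalIdeal R) (hr0 : r ≠ 0) :
    Module.Injective (R ⧸ Ideal.span {r})
      (E ⧸ (Ideal.span {r} • (⊤ : Submodule R E))) := by
  refine ⟨fun X Y _ _ _ _ i hi f ↦ ?_⟩
  let := Module.compHom X (algebraMap R (R ⧸ Ideal.span {r}))
  let := Module.compHom Y (algebraMap R (R ⧸ Ideal.span {r}))
  have hs : Function.Surjective (algebraMap R (R ⧸ Ideal.span {r})) :=
    Ideal.Quotient.mk_surjective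
  have : IsScalarTower R (R ⧸ Ideal.span {r}) X :=
    IsScalarTower.of_algebraMap_smul fun _ _ ↦ rfl
  have : IsScalarTower R (R ⧸ Ideal.span {r}) Y :=
    IsScalarTower.of_algebraMap_smul fun _ _ ↦ rfl
  have : IsScalarTower R (R ⧸ Ideal.span {r}) (E ⧸ (Ideal.span {r} • (⊤ : Submodule R E))) :=
    IsScalarTower.of_algebraMap_smul fun a x ↦ by
      obtain ⟨x, rfl⟩ := Submodule.Quotient.mk_surjective _ x
      rfl
  have hY : Module.IsTorsionBy R Y r := fun y ↦ by
    rw [← algebraMap_smul (R ⧸ Ideal.span {r}) r y, Ideal.Quotient.algebraMap_eq,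
      Ideal.Quotient.eq_zero_iff_mem.2 (Ideal.mem_span_singleton_self r), zero_smul]
  have hker : ∀ x : E, (Ideal.span {r} • (⊤ : Submodule R E)).mkQ x = 0 ↔ ∃ y, r • y = x := by
    intro x
    rw [Submodule.mkQ_apply, Submodule.Quotient.mk_eq_zero, Submodule.ideal_span_singleton_smul,
      Submodule.mem_smul_pointwise_iff_exists]
    simp
  obtain ⟨h, hh⟩ := hE.exists_extension_of_isTorsionBy hchain _ (Submodule.mkQ_surjective _)
    hker hY (i.restrictScalars R) hi (f.restrictScalars R)
  exact ⟨h.extendScalarsOfSurjective hs, hh⟩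
end

section
/- Let $R$ be a valuation ring, let $U$ be an $R$-module, let $F$ be a flat $R$-module, and let $r, s \in R$. Then the natural map $F \otimes_R (sU :_U r) \to F \otimes_R U$ induced by the inclusion $(sU :_U r) \subseteq U$ is injective, and its image is exactly $(s(F \otimes_R U) :_{F \otimes_R U} r)$; in particular $F \otimes_R (sU :_U r) \cong (s(F \otimes_R U) :_{F \otimes_R U} r)$. -/
open TensorProduct

/-- The submodule `sU` is the range of multiplication by `s` on `U`. -/
theorem span_singleton_smul_top_eq_range {R U : Type*} [CommRing R] [AddCommGroup U] [Module R U]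
    (s : R) :
    Ideal.span {s} • (⊤ : Submodule R U) = LinearMap.range (s • (LinearMap.id : U →ₗ[R] U)) := by
  ext u
  simp [Submodule.ideal_span_singleton_smul, Submodule.mem_smul_pointwise_iff_exists]

/-- Let `R` be a valuation ring, `U` an `R`-module, `F` a flat `R`-module and
`r, s ∈ R`.  Then the natural map `F ⊗ (sU :_U r) → F ⊗ U` induced by the inclusion
`(sU :_U r) ⊆ U` is injective and its image is exactly `(s(F ⊗ U) :_{F ⊗ U} r)`; in
particular `F ⊗ (sU :_U r) ≅ (s(F ⊗ U) :_{F ⊗ U} r)`.  Here `(sU :_U r) = {u | r • u ∈ sU}`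
is written as the comap of the submodule `sU = span{s} • ⊤` under multiplication by `r`. -/
theorem flat_tensor_colon {R : Type*} [CommRing R]
    (hchain : ∀ a b : R, ∃ c : R, a * c = b ∨ b * c = a)
    {U F : Type*} [AddCommGroup U] [Module R U] [AddCommGroup F] [Module R F]
    (hF : Module.Flat R F) (r s : R) :
    Function.Injective
        (LinearMap.lTensor F
          (Submodule.comap (r • (LinearMap.id : U →ₗ[R] U))
            (Ideal.span {s} • (⊤ : Submodule R U))).subtype) ∧
      LinearMap.range
          (LinearMap.lTensor F
            (Submodule.comap (r • (LinearMap.id : U →ₗ[R] U))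
              (Ideal.span {s} • (⊤ : Submodule R U))).subtype) =
        Submodule.comap (r • (LinearMap.id : F ⊗[R] U →ₗ[R] F ⊗[R] U))
          (Ideal.span {s} • (⊤ : Submodule R (F ⊗[R] U))) := by
  refine ⟨Module.Flat.lTensor_preserves_injective_linearMap _ (Submodule.injective_subtype _), ?_⟩
  have hexact : Function.Exact
      (Submodule.comap (r • (LinearMap.id : U →ₗ[R] U))
        (Ideal.span {s} • (⊤ : Submodule R U))).subtype
      ((Ideal.span {s} • (⊤ : Submodule R U)).mkQ ∘ₗ (r • LinearMap.id)) := by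
    rw [LinearMap.exact_iff, LinearMap.ker_comp, Submodule.ker_mkQ, Submodule.range_subtype]
  have hexact_mul : Function.Exact (s • (LinearMap.id : U →ₗ[R] U))
      (Ideal.span {s} • (⊤ : Submodule R U)).mkQ := by
    rw [LinearMap.exact_iff, Submodule.ker_mkQ, span_singleton_smul_top_eq_range]
  rw [← LinearMap.exact_iff.mp (Module.Flat.lTensor_exact F hexact), LinearMap.lTensor_comp,
    LinearMap.ker_comp, LinearMap.exact_iff.mp (Module.Flat.lTensor_exact F hexact_mul),
    LinearMap.lTensor_smul, LinearMap.lTensor_smul, LinearMap.lTensor_id,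
    span_singleton_smul_top_eq_range]
end

section
/- Let $R$ be a valuation ring and let $F$ be a pure-injective $R$-module. If $(x_i)_{i \in I}$ is a family of elements of $F$ and $(A_i)_{i \in I}$ is a family of ideals of $R$ such that the family of cosets $(x_i + A_iF)_{i \in I}$ has the finite intersection property (every finite subfamily has nonempty intersection), then $\bigcap_{i \in I} (x_i + A_iF)$ is nonempty. -/
universe u v

/-- A linear map is *pure* if it stays injective after tensoring with any module. -/
def LinearMap.IsPure {R : Type u} [CommRing R] {N P : Type v} [AddCommGroup N] [Module R N]
    [AddCommGroup P] [Module R P] (f : N →ₗ[R] P) : Prop :=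
  ∀ (L : Type v) [AddCommGroup L] [Module R L], Function.Injective (LinearMap.rTensor L f)

/-- A module `M` is *pure-injective* if every linear map to `M` extends along any pure
injection; this is equivalent to the exactness of `0 → Hom(L,M) → Hom(P,M) → Hom(N,M) → 0`
for every pure exact sequence `0 → N → P → L → 0`. -/
def IsPureInjective (R : Type u) (M : Type v) [CommRing R] [AddCommGroup M]
    [Module R M] : Prop :=
  ∀ ⦃N P : Type max u v⦄ [AddCommGroup N] [Module R N] [AddCommGroup P] [Module R P]
    (f : N →ₗ[R] P), Function.Injective f → f.IsPure →
    ∀ g : N →ₗ[R] M, ∃ h : P →ₗ[R] M, h.comp f = g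

open Filter in
/-- The functions that vanish eventually along a filter; the quotient by this submodule is the
reduced power of `F`. -/
def eventuallyZero (R : Type u) [CommRing R] {D : Type*} (l : Filter D) (F : Type*)
    [AddCommGroup F] [Module R F] : Submodule R (D → F) where
  carrier := {f | ∀ᶠ d in l, f d = 0}
  add_mem' {f g} hf hg := by
    filter_upwards [hf, hg] with d h₁ h₂
    simp [h₁, h₂]
  zero_mem' := Eventually.of_forall fun _ => rfl
  smul_mem' a f hf := by
    filter_upwards [hf] with d h
    simp [h]

/-- The diagonal map from a module to its reduced power. -/
def reducedPowerDiagonal (R : Type u) [CommRing R] {D : Type*} (l : Filter D) (F : Type*)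
    [AddCommGroup F] [Module R F] : F →ₗ[R] (D → F) ⧸ eventuallyZero R l F :=
  (eventuallyZero R l F).mkQ ∘ₗ LinearMap.pi fun _ => LinearMap.id

theorem reducedPowerDiagonal_injective (R : Type u) [CommRing R] {D : Type*} (l : Filter D)
    [l.NeBot] (F : Type*) [AddCommGroup F] [Module R F] :
    Function.Injective (reducedPowerDiagonal R l F) := by
  rw [injective_iff_map_eq_zero]
  intro a ha
  obtain ⟨_, hd⟩ := Filter.Eventually.exists ((Submodule.Quotient.mk_eq_zero _).1 ha)
  exact hd

theorem eventually_rTensor_proj_eq_zero {R : Type u} [CommRing R] {D : Type*} (l : Filter D)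
    {F L : Type*} [AddCommGroup F] [Module R F] [AddCommGroup L] [Module R L]
    (w : TensorProduct R (eventuallyZero R l F) L) :
    ∀ᶠ d in l, LinearMap.rTensor L (LinearMap.proj d : (D → F) →ₗ[R] F)
      (LinearMap.rTensor L (eventuallyZero R l F).subtype w) = 0 := by
  induction w with
  | zero => simp
  | tmul f m =>
    filter_upwards [f.2] with d hd
    simp [hd]
  | add a b ha hb =>
    filter_upwards [ha, hb] with d h₁ h₂
    simp [h₁, h₂]

theorem reducedPowerDiagonal_isPure (R : Type u) [CommRing R] {D : Type v} (l : Filter D)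
    [l.NeBot] (F : Type v) [AddCommGroup F] [Module R F] :
    (reducedPowerDiagonal R l F).IsPure := by
  intro L _ _
  rw [injective_iff_map_eq_zero]
  intro a ha
  rw [reducedPowerDiagonal, LinearMap.rTensor_comp_apply] at ha
  obtain ⟨w, hw⟩ := (rTensor_exact L (LinearMap.exact_subtype_mkQ (eventuallyZero R l F))
    (Submodule.mkQ_surjective _) _).1 ha
  obtain ⟨d, hd⟩ := (eventually_rTensor_proj_eq_zero l w).exists
  rw [hw, ← LinearMap.rTensor_comp_apply] at hd
  simpa [LinearMap.proj_pi] using hd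

/-- A finitely solvable system of congruences modulo multiples of ring elements is solvable in a
pure-injective module. -/
theorem IsPureInjective.exists_forall_sub_eq_smul {R : Type u} [CommRing R] {F : Type v}
    [AddCommGroup F] [Module R F] (hF : IsPureInjective R F) {κ : Type max u v}
    (c : κ → F) (r : κ → R)
    (hfin : ∀ t : Finset κ, ∃ y : F, ∀ k ∈ t, ∃ z : F, y - c k = r k • z) :
    ∃ y : F, ∀ k, ∃ z : F, y - c k = r k • z := by
  classical
  choose! y z hyz using hfin
  let l : Filter (Finset κ) := Filter.atTop
  let E := eventuallyZero R l (ULift.{max u v} F)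
  obtain ⟨h, hh⟩ := hF (reducedPowerDiagonal R l (ULift.{max u v} F))
    (reducedPowerDiagonal_injective R l _) (reducedPowerDiagonal_isPure R l _)
    ULift.moduleEquiv.toLinearMap
  refine ⟨h (E.mkQ fun t => ⟨y t⟩), fun k => ⟨h (E.mkQ fun t => ⟨z t k⟩), ?_⟩⟩
  have hc : h (E.mkQ fun _ => ⟨c k⟩) = c k := LinearMap.congr_fun hh ⟨c k⟩
  rw [← map_smul, ← map_smul]
  change _ - c k = _
  rw [← hc]
  rw [← map_sub, ← map_sub]
  congr 1
  refine (Submodule.Quotient.eq _).2 ?_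
  change ∀ᶠ t in l, _
  filter_upwards [Filter.eventually_ge_atTop ({k} : Finset κ)] with t ht
  ext
  simpa [sub_eq_zero] using hyz t k (Finset.singleton_subset_iff.1 ht)

/-- Let `R` be a valuation ring and `F` a pure-injective `R`-module.  If
`(xᵢ)ᵢ` is a family of elements of `F` and `(Aᵢ)ᵢ` a family of ideals of `R` such that the
family of cosets `(xᵢ + AᵢF)ᵢ` has the finite intersection property, then
`⋂ i, (xᵢ + AᵢF)` is nonempty. -/
theorem pureInjective_finite_intersection_property {R : Type u} [CommRing R]
    (hchain : ∀ a b : R, ∃ c : R, a * c = b ∨ b * c = a)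
    {F : Type v} [AddCommGroup F] [Module R F] (hF : IsPureInjective R F)
    {ι : Type*} (x : ι → F) (A : ι → Ideal R)
    (hfip : ∀ t : Finset ι,
      (⋂ i ∈ t, {y : F | y - x i ∈ A i • (⊤ : Submodule R F)}).Nonempty) :
    (⋂ i, {y : F | y - x i ∈ A i • (⊤ : Submodule R F)}).Nonempty := by
  classical
  have hsub : ∀ i j, A i ≤ A j → x i - x j ∈ A j • (⊤ : Submodule R F) := by
    intro i j hij
    obtain ⟨y, hy⟩ := hfip {i, j}
    simp only [Set.mem_iInter, Set.mem_ofPred_eq] at hy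
    have hi := Submodule.smul_mono_left hij (hy i (by simp))
    simpa using sub_mem (hy j (by simp)) hi
  by_cases hmin : ∃ i, ∀ j, A i ≤ A j
  · obtain ⟨i, hi⟩ := hmin
    exact ⟨x i, Set.mem_iInter.2 fun j => hsub i j (hi j)⟩
  push Not at hmin
  have hprincipal : ∀ i, ∃ j, ∃ r ∈ A i, A j ≤ Ideal.span {r} := by
    intro i
    obtain ⟨j, hj⟩ := hmin i
    obtain ⟨r, hri, hrj⟩ := SetLike.not_le_iff_exists.1 hj
    refine ⟨j, r, hri, fun b hb => ?_⟩
    obtain ⟨c, hc | hc⟩ := hchain r b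
    · exact Ideal.mem_span_singleton.2 ⟨c, hc.symm⟩
    · exact absurd (hc ▸ (A j).mul_mem_right c hb) hrj
  let S : Set (F × R) := {p | ∃ j, p.1 = x j ∧ A j ≤ Ideal.span {p.2}}
  choose j hxj hAj using fun p : S => p.2
  obtain ⟨y, hy⟩ := hF.exists_forall_sub_eq_smul (fun p : S => p.1.1) (fun p : S => p.1.2) (by
    intro t
    obtain ⟨y, hy⟩ := hfip (t.image j)
    simp only [Set.mem_iInter, Set.mem_ofPred_eq] at hy
    refine ⟨y, fun p hp => ?_⟩
    have hmem := Submodule.smul_mono_left (hAj p) (hy (j p) (Finset.mem_image_of_mem j hp))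
    rw [Submodule.ideal_span_singleton_smul] at hmem
    obtain ⟨z, -, hz⟩ := Submodule.mem_smul_pointwise_iff_exists _ _ _ |>.1 hmem
    exact ⟨z, by rw [hz, hxj p]⟩)
  refine ⟨y, Set.mem_iInter.2 fun i => ?_⟩
  obtain ⟨k, r, hr, hk⟩ := hprincipal i
  obtain ⟨z, hz⟩ := hy ⟨(x k, r), k, rfl, hk⟩
  have hyk : y - x k ∈ A i • (⊤ : Submodule R F) :=
    hz ▸ Submodule.smul_mem_smul hr Submodule.mem_top
  have hki : A k ≤ A i := hk.trans ((Ideal.span_singleton_le_iff_mem _).2 hr)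
  simpa using add_mem hyk (hsub k i hki)
end

section
/- Let $R$ be a valuation ring and let $F$ be a flat $R$-module with the following property: whenever $(x_i)_{i \in I}$ is a family of elements of $F$ and $(A_i)_{i \in I}$ is a family of ideals of $R$ such that the family of cosets $(x_i + A_iF)_{i \in I}$ has the finite intersection property, the intersection $\bigcap_{i \in I} (x_i + A_iF)$ is nonempty. Then $F$ is pure-injective. -/
universe u v

/-- A linear map is *relatively divisible* if divisibility by a scalar is reflected along it. -/
def LinearMap.IsRelativelyDivisible {R F M : Type*} [CommRing R] [AddCommGroup F] [Module R F]
    [AddCommGroup M] [Module R M] (i : F →ₗ[R] M) : Prop :=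
  ∀ (r : R) (x : F) (m : M), i x = r • m → ∃ y, x = r • y

theorem LinearMap.IsRelativelyDivisible.injective {R F M : Type*} [CommRing R] [AddCommGroup F]
    [Module R F] [AddCommGroup M] [Module R M] {i : F →ₗ[R] M} (hi : i.IsRelativelyDivisible) :
    Function.Injective i := by
  refine (injective_iff_map_eq_zero i).2 fun x hx => ?_
  obtain ⟨y, hy⟩ := hi 0 x 0 (by simpa using hx)
  simpa using hy

theorem LinearMap.IsPure.isRelativelyDivisible {R : Type u} [CommRing R] {N P : Type max u v}
    [AddCommGroup N] [Module R N] [AddCommGroup P] [Module R P] {f : N →ₗ[R] P}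
    (hf : f.IsPure) : f.IsRelativelyDivisible := by
  intro r x p hx
  let L := ULift.{v} (R ⧸ Ideal.span {r})
  let rN : Submodule R N := LinearMap.range (LinearMap.lsmul R N r)
  let e : L ≃ₗ[R] (R ⧸ Ideal.span {r}) := ULift.moduleEquiv
  let ψ : (R ⧸ Ideal.span {r}) →ₗ[R] (N →ₗ[R] N ⧸ rN) :=
    Submodule.liftQ _ (LinearMap.toSpanSingleton R (N →ₗ[R] N ⧸ rN) rN.mkQ) (by
      rw [Ideal.span, Submodule.span_le, Set.singleton_subset_iff]
      ext n
      change r • rN.mkQ n = 0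
      rw [← map_smul]
      exact (Submodule.Quotient.mk_eq_zero rN).2 ⟨n, rfl⟩)
  let one : L := e.symm (Submodule.Quotient.mk 1)
  have hone : r • one = 0 := by
    rw [← map_smul, ← Submodule.Quotient.mk_smul, LinearEquiv.map_eq_zero_iff,
      Submodule.Quotient.mk_eq_zero, smul_eq_mul, mul_one]
    exact Ideal.mem_span_singleton_self r
  have hzero : TensorProduct.tmul R x one = 0 := by
    apply hf L
    rw [map_zero, LinearMap.rTensor_tmul, hx, TensorProduct.smul_tmul, hone,
      TensorProduct.tmul_zero]
  have himage := congrArg (TensorProduct.lift (ψ.comp e.toLinearMap).flip) hzero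
  have hval : TensorProduct.lift (ψ.comp e.toLinearMap).flip (TensorProduct.tmul R x one) = rN.mkQ x := by
    rw [TensorProduct.lift.tmul, LinearMap.flip_apply, LinearMap.comp_apply,
      LinearEquiv.coe_coe, LinearEquiv.apply_symm_apply]
    change ((1 : R) • rN.mkQ) x = _
    rw [one_smul]
  rw [hval, map_zero] at himage
  obtain ⟨y, hy⟩ := (Submodule.Quotient.mk_eq_zero rN).1 himage
  exact ⟨y, hy.symm⟩

theorem Ideal.le_total_of_dvd_total {R : Type*} [CommRing R]
    (hchain : ∀ a b : R, ∃ c : R, a * c = b ∨ b * c = a) (A B : Ideal R) : A ≤ B ∨ B ≤ A := by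
  by_contra! h
  obtain ⟨⟨a, ha, haB⟩, ⟨b, hb, hbA⟩⟩ :=
    And.intro (SetLike.not_le_iff_exists.1 h.1) (SetLike.not_le_iff_exists.1 h.2)
  obtain ⟨c, rfl | rfl⟩ := hchain a b
  · exact hbA (A.mul_mem_right c ha)
  · exact haB (B.mul_mem_right c hb)

/-- The ideal `(r) : s`. -/
def Ideal.principalColon {R : Type*} [CommRing R] (r s : R) : Ideal R :=
  Submodule.comap (LinearMap.lsmul R R s) (Ideal.span {r})

theorem Ideal.mem_principalColon {R : Type*} [CommRing R] {r s a : R} :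
    a ∈ Ideal.principalColon r s ↔ r ∣ s * a :=
  Ideal.mem_span_singleton

theorem Module.Flat.mem_principalColon_smul_top_iff {R F : Type*} [CommRing R] [AddCommGroup F]
    [Module R F] [Module.Flat R F] {r s : R} {y : F} :
    y ∈ Ideal.principalColon r s • (⊤ : Submodule R F) ↔ ∃ n, s • y = r • n := by
  constructor
  · intro hy
    refine Submodule.smul_induction_on hy ?_ ?_
    · intro a ha n _
      obtain ⟨b, hb⟩ := Ideal.mem_principalColon.1 ha
      exact ⟨b • n, by rw [smul_smul, hb, mul_smul]⟩
    · rintro y z ⟨m, hm⟩ ⟨n, hn⟩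
      exact ⟨m + n, by rw [smul_add, smul_add, hm, hn]⟩
  · rintro ⟨n, hn⟩
    have hrel : ∑ i, (![s, -r] : Fin 2 → R) i • (![y, n] : Fin 2 → F) i = 0 := by
      simp [Fin.sum_univ_two, hn]
    obtain ⟨k, a, z, hz, ha⟩ := Module.Flat.isTrivialRelation_of_sum_smul_eq_zero hrel
    have hy : y = ∑ j, a 0 j • z j := hz 0
    rw [hy]
    refine Submodule.sum_mem _ fun j _ => Submodule.smul_mem_smul ?_ Submodule.mem_top
    rw [Ideal.mem_principalColon]
    have hj := ha j
    simp only [Fin.sum_univ_two, Matrix.cons_val_zero, Matrix.cons_val_one] at hj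
    exact ⟨a 1 j, by linear_combination hj⟩

section ValuationRing

variable {R F M : Type*} [CommRing R] [AddCommGroup F] [Module R F] [AddCommGroup M] [Module R M]

/-- A single congruence solvable in `M` is solvable in `F`. -/
theorem LinearMap.IsRelativelyDivisible.exists_solution
    (hchain : ∀ a b : R, ∃ c : R, a * c = b ∨ b * c = a) {i : F →ₗ[R] M}
    (hi : i.IsRelativelyDivisible) {x m : M} {s r : R} {f : F} (h : i f - s • x = r • m) :
    ∃ y n, f - s • y = r • n := by
  rw [sub_eq_iff_eq_add] at h
  obtain ⟨d, rfl | rfl⟩ := hchain s r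
  · obtain ⟨y, rfl⟩ := hi s f (x + d • m) (by rw [h]; module)
    exact ⟨y, 0, by simp⟩
  · obtain ⟨n, rfl⟩ := hi r f (d • x + m) (by rw [h]; module)
    exact ⟨0, n, by simp⟩

theorem LinearMap.IsRelativelyDivisible.exists_eq_smul_add_smul
    (hchain : ∀ a b : R, ∃ c : R, a * c = b ∨ b * c = a) {i : F →ₗ[R] M}
    (hi : i.IsRelativelyDivisible) {m₁ m₂ : M} {a b : R} {z : F}
    (h : i z = a • m₁ + b • m₂) : ∃ n₁ n₂, z = a • n₁ + b • n₂ := by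
  obtain ⟨y, n, hn⟩ := hi.exists_solution hchain (sub_eq_iff_eq_add'.2 h)
  exact ⟨y, n, sub_eq_iff_eq_add'.1 hn⟩

/-- Two congruences with a common solution in `M` have a common solution in `F`. -/
theorem LinearMap.IsRelativelyDivisible.exists_common_solution
    (hchain : ∀ a b : R, ∃ c : R, a * c = b ∨ b * c = a) {i : F →ₗ[R] M}
    (hi : i.IsRelativelyDivisible) {x m₁ m₂ : M} {s₁ s₂ r₁ r₂ : R} {f₁ f₂ : F}
    (h₁ : i f₁ - s₁ • x = r₁ • m₁) (h₂ : i f₂ - s₂ • x = r₂ • m₂) :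
    ∃ y, (∃ n, f₁ - s₁ • y = r₁ • n) ∧ ∃ n, f₂ - s₂ • y = r₂ • n := by
  have key : ∀ {m₁ m₂ : M} {s c r₁ r₂ : R} {f₁ f₂ : F}, i f₁ - s • x = r₁ • m₁ →
      i f₂ - (s * c) • x = r₂ • m₂ →
      ∃ y, (∃ n, f₁ - s • y = r₁ • n) ∧ ∃ n, f₂ - (s * c) • y = r₂ • n := by
    intro m₁ m₂ s c r₁ r₂ f₁ f₂ h₁ h₂
    have h₁' := sub_eq_iff_eq_add.1 h₁
    have h₂' := sub_eq_iff_eq_add.1 h₂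
    obtain ⟨d, rfl | rfl⟩ := hchain s r₁
    · obtain ⟨n₁, n₂, hn⟩ := hi.exists_eq_smul_add_smul hchain (z := c • f₁ - f₂)
        (a := s * d * c) (b := r₂) (m₁ := m₁) (m₂ := -m₂)
        (by rw [map_sub, map_smul, h₁', h₂']; module)
      obtain ⟨y, hy⟩ := hi s (f₁ - (s * d) • n₁) (x + d • m₁ - d • i n₁)
        (by rw [map_sub, map_smul, h₁']; module)
      refine ⟨y, ⟨n₁, ?_⟩, -n₂, ?_⟩
      · rw [← hy]; abel
      · have hf₂ : f₂ = c • f₁ - ((s * d * c) • n₁ + r₂ • n₂) := by rw [← hn]; abel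
        rw [mul_comm s c, mul_smul, ← hy, hf₂]
        module
    · obtain ⟨y, n, hn⟩ := hi.exists_solution hchain h₂
      obtain ⟨n₁, rfl⟩ := hi r₁ f₁ (d • x + m₁) (by rw [h₁']; module)
      exact ⟨y, ⟨n₁ - d • y, by module⟩, n, hn⟩
  obtain ⟨c, rfl | rfl⟩ := hchain s₁ s₂
  · exact key h₁ h₂
  · obtain ⟨y, hy₂, hy₁⟩ := key h₂ h₁
    exact ⟨y, hy₁, hy₂⟩

end ValuationRing

/-- Finitely many pairwise intersecting cosets of the submodules `A i • ⊤` have a common point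
as soon as the ideals `A i` form a chain. -/
theorem Submodule.exists_mem_forall_finset_of_pairwise {R F ι : Type*} [CommRing R]
    [AddCommGroup F] [Module R F] {x : ι → F} {A : ι → Ideal R}
    (hA : ∀ i j, A i ≤ A j ∨ A j ≤ A i)
    (hx : ∀ i j, ∃ y, y - x i ∈ A i • (⊤ : Submodule R F) ∧ y - x j ∈ A j • (⊤ : Submodule R F))
    (t : Finset ι) : ∃ y, ∀ i ∈ t, y - x i ∈ A i • (⊤ : Submodule R F) := by
  obtain rfl | ht := t.eq_empty_or_nonempty
  · exact ⟨0, by simp⟩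
  · obtain ⟨i, hi⟩ := t.exists_minimalFor A ht
    refine ⟨x i, fun j hj => ?_⟩
    obtain ⟨y, hyi, hyj⟩ := hx i j
    have hij : A i ≤ A j := (hA i j).elim id fun h => hi.2 hj h
    have := Submodule.sub_mem _ hyj (Submodule.smul_mono_left hij hyi)
    rwa [sub_sub_sub_cancel_left] at this

section FiniteIntersection

variable {R : Type u} [CommRing R] {F : Type v} [AddCommGroup F] [Module R F]
  {M : Type*} [AddCommGroup M] [Module R M]

theorem LinearMap.IsRelativelyDivisible.exists_approximation
    (hchain : ∀ a b : R, ∃ c : R, a * c = b ∨ b * c = a) [Module.Flat R F]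
    (hfip : ∀ {ι : Type max u v} (x : ι → F) (A : ι → Ideal R),
      (∀ t : Finset ι,
        (⋂ i ∈ t, {y : F | y - x i ∈ A i • (⊤ : Submodule R F)}).Nonempty) →
      (⋂ i, {y : F | y - x i ∈ A i • (⊤ : Submodule R F)}).Nonempty)
    {i : F →ₗ[R] M} (hi : i.IsRelativelyDivisible) (x : M) :
    ∃ y, ∀ (s r : R) (f : F) (m : M), i f - s • x = r • m → ∃ n, f - s • y = r • n := by
  let ι := {p : R × R × F // ∃ m, i p.2.2 - p.1 • x = p.2.1 • m}
  have hsol (p : ι) : ∃ y n, p.1.2.2 - p.1.1 • y = p.1.2.1 • n :=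
    hi.exists_solution hchain p.2.choose_spec
  choose y₀ n₀ hy₀ using hsol
  let A (p : ι) : Ideal R := Ideal.principalColon p.1.2.1 p.1.1
  have hmem (p : ι) (y : F) : y - y₀ p ∈ A p • (⊤ : Submodule R F) ↔
      ∃ n, p.1.2.2 - p.1.1 • y = p.1.2.1 • n := by
    have hp := sub_eq_iff_eq_add.1 (hy₀ p)
    rw [Module.Flat.mem_principalColon_smul_top_iff]
    constructor
    · rintro ⟨n, hn⟩
      exact ⟨n₀ p - n, by rw [smul_sub, ← hn, hp]; module⟩
    · rintro ⟨n, hn⟩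
      exact ⟨n₀ p - n, by rw [smul_sub _ (n₀ p), ← hn, hp]; module⟩
  obtain ⟨y, hy⟩ := hfip y₀ A fun t => by
    obtain ⟨y, hy⟩ := Submodule.exists_mem_forall_finset_of_pairwise (x := y₀) (A := A)
      (fun _ _ => Ideal.le_total_of_dvd_total hchain _ _) (fun p q => by
        obtain ⟨y, hp, hq⟩ := hi.exists_common_solution hchain p.2.choose_spec q.2.choose_spec
        exact ⟨y, (hmem p y).2 hp, (hmem q y).2 hq⟩) t
    exact ⟨y, by simpa using hy⟩
  refine ⟨y, fun s r f m h => ?_⟩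
  exact (hmem ⟨(s, r, f), m, h⟩ y).1 (Set.mem_iInter.1 hy _)

/-- Under the finite intersection property, every relatively divisible map out of `F` splits. -/
theorem LinearMap.IsRelativelyDivisible.exists_retraction
    (hchain : ∀ a b : R, ∃ c : R, a * c = b ∨ b * c = a) [Module.Flat R F]
    (hfip : ∀ {ι : Type max u v} (x : ι → F) (A : ι → Ideal R),
      (∀ t : Finset ι,
        (⋂ i ∈ t, {y : F | y - x i ∈ A i • (⊤ : Submodule R F)}).Nonempty) →
      (⋂ i, {y : F | y - x i ∈ A i • (⊤ : Submodule R F)}).Nonempty)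
    {i : F →ₗ[R] M} (hi : i.IsRelativelyDivisible) :
    ∃ ρ : M →ₗ[R] F, ρ ∘ₗ i = LinearMap.id := by
  have mem_iff (K : Submodule R M) : (K.mkQ ∘ₗ i).IsRelativelyDivisible ↔
      ∀ (r : R) (f : F) (m : M), i f - r • m ∈ K → ∃ n, f = r • n := by
    refine forall_congr' fun r => forall_congr' fun f => ?_
    rw [(Submodule.mkQ_surjective K).forall]
    refine forall_congr' fun m => ?_
    rw [LinearMap.comp_apply, ← map_smul, ← sub_eq_zero, ← map_sub, Submodule.mkQ_apply,
      Submodule.Quotient.mk_eq_zero]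
  obtain ⟨K, -, hK⟩ := zorn_le_nonempty₀
    {K : Submodule R M | (K.mkQ ∘ₗ i).IsRelativelyDivisible} (fun c hc hchn K₀ hK₀ => by
      refine ⟨sSup c, (mem_iff _).2 fun r f m h => ?_, fun K hK => le_sSup hK⟩
      obtain ⟨K, hK, hmem⟩ := (Submodule.mem_sSup_of_directed ⟨K₀, hK₀⟩ hchn.directedOn).1 h
      exact (mem_iff K).1 (hc hK) r f m hmem)
    ⊥ ((mem_iff ⊥).2 fun r f m h => hi r f m (sub_eq_zero.1 ((Submodule.mem_bot R).1 h)))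
  have hKdiv : (K.mkQ ∘ₗ i).IsRelativelyDivisible := hK.prop
  have hsurj : Function.Surjective (K.mkQ ∘ₗ i) := by
    intro q
    obtain ⟨x, rfl⟩ := Submodule.mkQ_surjective K q
    obtain ⟨y, hy⟩ := hKdiv.exists_approximation hchain hfip (K.mkQ x)
    have hle : K ⊔ Submodule.span R {x - i y} ≤ K := by
      refine hK.le_of_ge ((mem_iff _).2 fun r f m h => ?_) le_sup_left
      obtain ⟨k, hk, z, hz, hkz⟩ := Submodule.mem_sup.1 h
      obtain ⟨s, rfl⟩ := Submodule.mem_span_singleton.1 hz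
      obtain ⟨n, hn⟩ := hy s r (f + s • y) (K.mkQ m) (by
        have hkz' : i (f + s • y) - s • x = k + r • m := by
          rw [map_add, map_smul, sub_eq_iff_eq_add.1 hkz.symm]; module
        rw [LinearMap.comp_apply, ← map_smul K.mkQ s x, ← map_sub, hkz', map_add, map_smul,
          Submodule.mkQ_apply, (Submodule.Quotient.mk_eq_zero K).2 hk, zero_add])
      exact ⟨n, by rw [← hn]; abel⟩
    have hxy : x - i y ∈ K :=
      hle (Submodule.mem_sup_right (Submodule.mem_span_singleton_self _))
    exact ⟨y, ((Submodule.Quotient.eq K).2 hxy).symm⟩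
  let e : F ≃ₗ[R] M ⧸ K := LinearEquiv.ofBijective (K.mkQ ∘ₗ i) ⟨hKdiv.injective, hsurj⟩
  exact ⟨e.symm.toLinearMap ∘ₗ K.mkQ, LinearMap.ext fun f => e.symm_apply_apply f⟩

end FiniteIntersection

/-- The pushout of a relatively divisible map is relatively divisible. -/
theorem LinearMap.IsRelativelyDivisible.pushout {R N P F : Type*} [CommRing R]
    [AddCommGroup N] [Module R N] [AddCommGroup P] [Module R P] [AddCommGroup F] [Module R F]
    {f : N →ₗ[R] P} (hf : f.IsRelativelyDivisible) (g : N →ₗ[R] F) :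
    ((LinearMap.range (g.prod (-f))).mkQ ∘ₗ LinearMap.inl R F P).IsRelativelyDivisible := by
  intro r x q hx
  obtain ⟨⟨a, b⟩, rfl⟩ := Submodule.mkQ_surjective _ q
  rw [LinearMap.comp_apply, ← map_smul, Submodule.mkQ_apply, Submodule.mkQ_apply,
    Submodule.Quotient.eq] at hx
  obtain ⟨n, hn⟩ := hx
  have h₁ : g n = x - r • a := congrArg Prod.fst hn
  have h₂ : -f n = 0 - r • b := congrArg Prod.snd hn
  obtain ⟨n', rfl⟩ := hf r n b (by simpa using h₂)
  rw [map_smul, eq_sub_iff_add_eq] at h₁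
  exact ⟨g n' + a, by rw [← h₁, smul_add]⟩

/-- Let `R` be a valuation ring and `F` a flat `R`-module such that every
family of cosets `(xᵢ + AᵢF)ᵢ` (for `xᵢ ∈ F` and ideals `Aᵢ` of `R`) with the finite
intersection property has nonempty intersection.  Then `F` is pure-injective. -/
theorem pureInjective_of_flat_of_finite_intersection_property {R : Type u} [CommRing R]
    (hchain : ∀ a b : R, ∃ c : R, a * c = b ∨ b * c = a)
    {F : Type v} [AddCommGroup F] [Module R F] (hflat : Module.Flat R F)
    (hfip : ∀ {ι : Type max u v} (x : ι → F) (A : ι → Ideal R),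
      (∀ t : Finset ι,
        (⋂ i ∈ t, {y : F | y - x i ∈ A i • (⊤ : Submodule R F)}).Nonempty) →
      (⋂ i, {y : F | y - x i ∈ A i • (⊤ : Submodule R F)}).Nonempty) :
    IsPureInjective R F := by
  intro N P _ _ _ _ f _ hpure g
  let K := LinearMap.range (g.prod (-f))
  obtain ⟨ρ, hρ⟩ := (hpure.isRelativelyDivisible.pushout g).exists_retraction hchain hfip
  refine ⟨ρ ∘ₗ K.mkQ ∘ₗ LinearMap.inr R F P, LinearMap.ext fun n => ?_⟩
  have hglue : K.mkQ (0, f n) = K.mkQ (g n, 0) := by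
    refine ((Submodule.Quotient.eq K).2 ⟨n, ?_⟩).symm
    simp
  change ρ (K.mkQ (0, f n)) = g n
  rw [hglue]
  exact LinearMap.congr_fun hρ (g n)
end

section
/- Let $R$ be a valuation ring, let $F$ be a flat pure-injective $R$-module, and let $J$ be a prime ideal of $R$. Then the localization $F_J$ is a pure-injective $R$-module. -/
universe u v

/-- A partially defined linear map *preserves divisibility* if it sends elements of its domain
divisible by `a` in the ambient module to elements divisible by `a`. -/
def LinearPMap.PreservesDiv {R : Type*} [CommRing R] {P M : Type*} [AddCommGroup P] [Module R P]
    [AddCommGroup M] [Module R M] (h : P →ₗ.[R] M) : Prop :=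
  ∀ (a : R) (n : h.domain) (p : P), (n : P) = a • p → ∃ m : M, h n = a • m

/-- The submodule of all `m` such that `r • m` is divisible by `r * c`. -/
def divColon {R : Type*} [CommRing R] (M : Type*) [AddCommGroup M] [Module R M] (r c : R) :
    Submodule R M :=
  (LinearMap.range (LinearMap.lsmul R M (r * c))).comap (LinearMap.lsmul R M r)

section

variable {R : Type*} [CommRing R] {M : Type*} [AddCommGroup M] [Module R M]

lemma mem_divColon {r c : R} {m : M} : m ∈ divColon M r c ↔ ∃ w, (r * c) • w = r • m := by
  simp [divColon]

lemma smul_mem_divColon (r c : R) (w : M) : c • w ∈ divColon M r c :=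
  mem_divColon.2 ⟨w, mul_smul _ _ _⟩

lemma mem_divColon_of_smul_eq_zero {r c : R} {m : M} (h : r • m = 0) : m ∈ divColon M r c :=
  mem_divColon.2 ⟨0, by simp [h]⟩

lemma divColon_le_sup (r₁ c₁ r₂ c₂ : R) {c : R} (hc : c = c₁ ∨ c = c₂) :
    divColon M r₂ c ≤ divColon M r₁ c₁ ⊔ divColon M r₂ c₂ := by
  rcases hc with rfl | rfl
  · intro m hm
    obtain ⟨w, hw⟩ := mem_divColon.1 hm
    have h1 : r₂ • (m - c • w) = 0 := by rw [smul_sub, ← mul_smul, hw, sub_self]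
    have := Submodule.add_mem_sup (smul_mem_divColon r₁ c w)
      (mem_divColon_of_smul_eq_zero (c := c₂) h1)
    simpa using this
  · exact le_sup_right

/-- Extending a divisibility preserving map to one more element amounts to solving a system of
congruences modulo the submodules `divColon`, any two of which are compatible. -/
lemma LinearPMap.PreservesDiv.sub_mem_sup (hR : ∀ a b : R, a ∣ b ∨ b ∣ a) {P : Type*}
    [AddCommGroup P] [Module R P] {h : P →ₗ.[R] M} (hh : h.PreservesDiv) {x : P}
    {r₁ c₁ r₂ c₂ : R} {n₁ n₂ : h.domain} {p₁ p₂ : P} (h₁ : r₁ • x + n₁ = (r₁ * c₁) • p₁)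
    (h₂ : r₂ • x + n₂ = (r₂ * c₂) • p₂) {z₁ z₂ : M} (hz₁ : h n₁ = -(r₁ • z₁))
    (hz₂ : h n₂ = -(r₂ • z₂)) (hr : r₁ ∣ r₂) :
    z₁ - z₂ ∈ divColon M r₁ c₁ ⊔ divColon M r₂ c₂ := by
  obtain ⟨t, rfl⟩ := hr
  obtain ⟨c, hc, ⟨e₁, rfl⟩, ⟨e₂, rfl⟩⟩ : ∃ c, (c = c₁ ∨ c = c₂) ∧ c ∣ c₁ ∧ c ∣ c₂ := by
    rcases hR c₁ c₂ with h | h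
    · exact ⟨c₁, .inl rfl, dvd_rfl, h⟩
    · exact ⟨c₂, .inr rfl, h, dvd_rfl⟩
  refine divColon_le_sup r₁ _ (r₁ * t) _ hc ?_
  obtain ⟨m, hm⟩ := hh (r₁ * t * c) (n₂ - t • n₁) (e₂ • p₂ - e₁ • p₁) (by
    have e₁' : (n₁ : P) = (r₁ * (c * e₁)) • p₁ - r₁ • x := by rw [← h₁]; abel
    have e₂' : (n₂ : P) = (r₁ * t * (c * e₂)) • p₂ - (r₁ * t) • x := by rw [← h₂]; abel
    push_cast
    rw [e₁', e₂']
    module)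
  refine mem_divColon.2 ⟨m, ?_⟩
  rw [← hm, LinearPMap.map_sub, LinearPMap.map_smul, hz₁, hz₂]
  module

lemma LinearPMap.exists_preservesDiv_extend {P : Type*}
    [AddCommGroup P] [Module R P] {h : P →ₗ.[R] M} (x : P) (z : M)
    (hz : ∀ (a r : R) (n : h.domain) (p : P), r • x + n = a • p → ∃ m, r • z + h n = a • m) :
    ∃ k : P →ₗ.[R] M, h ≤ k ∧ x ∈ k.domain ∧ k.PreservesDiv := by
  have H : ∀ c : R, c • x = 0 → RingHom.id R c • z = 0 := by
    intro c hc
    obtain ⟨m, hm⟩ := hz 0 c 0 0 (by simp [hc])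
    simpa using hm
  have H' : ∀ (n : h.domain) (y : (LinearPMap.mkSpanSingleton' x z H).domain),
      (n : P) = y → h n = LinearPMap.mkSpanSingleton' x z H y := by
    rintro n ⟨y, hy⟩ hn
    obtain ⟨c, rfl⟩ := Submodule.mem_span_singleton.1 hy
    rw [LinearPMap.mkSpanSingleton'_apply]
    obtain ⟨m, hm⟩ := hz 0 (-c) n 0 (by simp [hn])
    simp only [neg_smul, zero_smul] at hm
    simpa using (neg_add_eq_zero.1 hm).symm
  refine ⟨h.sup _ H', LinearPMap.left_le_sup _ _ _,
    (LinearPMap.right_le_sup _ _ H').1 (Submodule.mem_span_singleton_self x), ?_⟩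
  rintro a ⟨n, hn⟩ p hp
  obtain ⟨n', hn', y, hy, rfl⟩ := Submodule.mem_sup.1 hn
  obtain ⟨c, rfl⟩ := Submodule.mem_span_singleton.1 hy
  have hsup := LinearPMap.sup_apply H' ⟨n', hn'⟩ ⟨c • x, hy⟩ ⟨n' + c • x, hn⟩ rfl
  rw [LinearPMap.mkSpanSingleton'_apply] at hsup
  obtain ⟨m, hm⟩ := hz a c ⟨n', hn'⟩ p (by rw [← hp]; exact add_comm _ _)
  exact ⟨m, hsup.trans (by rw [← hm, add_comm]; rfl)⟩

end

/-- Over a ring whose divisibility relation is total, a map preserving divisibility into a module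
in which pairwise compatible systems of congruences are solvable can be extended to any element. -/
lemma LinearPMap.PreservesDiv.exists_extend_of_solvable {R : Type u} [CommRing R]
    (hR : ∀ a b : R, a ∣ b ∨ b ∣ a) {M : Type v} [AddCommGroup M] [Module R M]
    (hM : ∀ (ι : Type (max u v)) (r c : ι → R) (z : ι → M),
      (∀ i j, z i - z j ∈ divColon M (r i) (c i) ⊔ divColon M (r j) (c j)) →
      ∃ y, ∀ i, y - z i ∈ divColon M (r i) (c i)) {P : Type max u v}
    [AddCommGroup P] [Module R P] {h : P →ₗ.[R] M} (hh : h.PreservesDiv) (x : P) :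
    ∃ k : P →ₗ.[R] M, h ≤ k ∧ x ∈ k.domain ∧ k.PreservesDiv := by
  let ι : Type (max u v) :=
    {t : R × R × h.domain // ∃ p, t.1 • x + (t.2.2 : P) = (t.1 * t.2.1) • p}
  have hz : ∀ t : ι, ∃ z : M, h t.1.2.2 = -(t.1.1 • z) := by
    rintro ⟨⟨r, c, n⟩, p, hp⟩
    dsimp only at hp ⊢
    obtain ⟨m, hm⟩ := hh r n (c • p - x) (by rw [smul_sub, ← mul_smul, ← hp]; abel)
    exact ⟨-m, by simp [hm]⟩
  choose z hz using hz
  obtain ⟨y, hy⟩ := hM ι (fun t => t.1.1) (fun t => t.1.2.1) z (fun s t => by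
    obtain ⟨p, hp⟩ := s.2
    obtain ⟨q, hq⟩ := t.2
    rcases hR s.1.1 t.1.1 with hst | hst
    · exact hh.sub_mem_sup hR hp hq (hz s) (hz t) hst
    · rw [← neg_mem_iff, neg_sub, sup_comm]
      exact hh.sub_mem_sup hR hq hp (hz t) (hz s) hst)
  refine LinearPMap.exists_preservesDiv_extend x y fun a r n p hp => ?_
  rcases hR r a with ⟨c, rfl⟩ | ⟨e, rfl⟩
  · let t : ι := ⟨⟨r, c, n⟩, p, hp⟩
    obtain ⟨w, hw⟩ := mem_divColon.1 (hy t)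
    refine ⟨w, ?_⟩
    have h1 : h n = -(r • z t) := hz t
    have h2 : (r * c) • w = r • (y - z t) := hw
    rw [h1, h2, smul_sub, sub_eq_add_neg]
  · obtain ⟨m, hm⟩ := hh a n (p - e • x) (by rw [smul_sub, ← mul_smul, ← hp]; abel)
    exact ⟨e • y + m, by rw [hm, smul_add, mul_smul]⟩

lemma LinearPMap.PreservesDiv.sSup {R : Type*} [CommRing R] {P M : Type*} [AddCommGroup P]
    [Module R P] [AddCommGroup M] [Module R M] {C : Set (P →ₗ.[R] M)}
    (hC : DirectedOn (· ≤ ·) C) (hne : C.Nonempty) (h : ∀ k ∈ C, k.PreservesDiv) :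
    (LinearPMap.sSup C hC).PreservesDiv := by
  rintro a ⟨n, hn⟩ p hp
  obtain ⟨k, hk, hnk⟩ := (LinearPMap.mem_domain_sSup_iff hne hC).1 hn
  obtain ⟨m, hm⟩ := h k hk a ⟨n, hnk⟩ p hp
  exact ⟨m, by rw [← hm]; exact LinearPMap.sSup_apply hC hk ⟨n, hnk⟩⟩

lemma LinearMap.IsPure.exists_eq_smul {R : Type u} [CommRing R] {N P : Type (max u v)}
    [AddCommGroup N] [Module R N] [AddCommGroup P] [Module R P] {f : N →ₗ[R] P} (hf : f.IsPure)
    {a : R} {n : N} {p : P} (h : f n = a • p) : ∃ n', n = a • n' := by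
  let A : Submodule R N := LinearMap.range (LinearMap.lsmul R N a)
  let L := ULift.{max u v} (R ⧸ Ideal.span {a})
  let q : (R ⧸ Ideal.span {a}) →ₗ[R] N →ₗ[R] N ⧸ A :=
    (Ideal.span {a}).liftQ ((LinearMap.lsmul R (N →ₗ[R] N ⧸ A)).flip A.mkQ) (by
      rw [Ideal.span, Submodule.span_le, Set.singleton_subset_iff]
      ext m
      simp only [LinearMap.flip_apply, LinearMap.lsmul_apply, LinearMap.smul_apply,
        Submodule.mkQ_apply, LinearMap.zero_apply]
      exact (Submodule.Quotient.mk_eq_zero A).2 ⟨m, rfl⟩)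
  let φ : TensorProduct R N L →ₗ[R] N ⧸ A :=
    TensorProduct.lift (q ∘ₗ (ULift.moduleEquiv (R := R)).toLinearMap).flip
  let e : L := ⟨1⟩
  have he : a • e = 0 := by
    refine ULift.ext _ _ ?_
    change a • (Ideal.Quotient.mk (Ideal.span {a}) 1) = 0
    rw [← Ideal.Quotient.mk_eq_mk, ← Submodule.Quotient.mk_smul, Submodule.Quotient.mk_eq_zero]
    simp
  have h0 : n ⊗ₜ[R] e = 0 := by
    apply hf L
    rw [LinearMap.rTensor_tmul, h, TensorProduct.smul_tmul, he, TensorProduct.tmul_zero, map_zero]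
  have h1 : φ (n ⊗ₜ[R] e) = A.mkQ n := by
    change (1 : R) • A.mkQ n = A.mkQ n
    exact one_smul _ _
  rw [h0, map_zero, eq_comm, Submodule.mkQ_apply, Submodule.Quotient.mk_eq_zero] at h1
  obtain ⟨m, hm⟩ := h1
  exact ⟨m, hm.symm⟩

/-- Over a ring whose divisibility relation is total, a module is pure-injective as soon as
pairwise compatible systems of congruences modulo the submodules `divColon` are solvable. -/
theorem isPureInjective_of_solvable {R : Type u} [CommRing R]
    (hR : ∀ a b : R, a ∣ b ∨ b ∣ a) {M : Type v} [AddCommGroup M] [Module R M]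
    (hM : ∀ (ι : Type (max u v)) (r c : ι → R) (z : ι → M),
      (∀ i j, z i - z j ∈ divColon M (r i) (c i) ⊔ divColon M (r j) (c j)) →
      ∃ y, ∀ i, y - z i ∈ divColon M (r i) (c i)) : IsPureInjective R M := by
  intro N P _ _ _ _ f hf hpure g
  let h₀ : P →ₗ.[R] M :=
    ⟨LinearMap.range f, g ∘ₗ (LinearEquiv.ofInjective f hf).symm.toLinearMap⟩
  have h₀_apply : ∀ (n : N) (hn : f n ∈ h₀.domain), h₀ ⟨f n, hn⟩ = g n := fun n hn =>
    congrArg g ((LinearEquiv.ofInjective f hf).symm_apply_apply n)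
  have h₀_div : h₀.PreservesDiv := by
    rintro a ⟨_, n, rfl⟩ p hp
    obtain ⟨n', rfl⟩ := hpure.exists_eq_smul hp
    exact ⟨g n', (h₀_apply _ _).trans (map_smul g a n')⟩
  obtain ⟨k, hk₀, hk⟩ := zorn_le_nonempty₀ {k : P →ₗ.[R] M | k.PreservesDiv} (by
    intro C hC hchain y hy
    exact ⟨LinearPMap.sSup C hchain.directedOn,
      LinearPMap.PreservesDiv.sSup hchain.directedOn ⟨y, hy⟩ hC,
      fun z hz => LinearPMap.le_sSup _ hz⟩) h₀ h₀_div
  have htop : ∀ x, x ∈ k.domain := by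
    intro x
    obtain ⟨k', hkk', hx, hk'⟩ := hk.prop.exists_extend_of_solvable hR hM x
    exact (hk.le_of_ge hk' hkk').1 hx
  refine ⟨k.toFun ∘ₗ LinearMap.id.codRestrict k.domain htop, ?_⟩
  ext n
  rw [← h₀_apply n ⟨n, rfl⟩]
  exact (hk₀.2 rfl).symm

/-- In a pure-injective module, a system of congruences modulo principal multiples which is
eventually solvable along a filter is solvable. -/
theorem IsPureInjective.exists_of_eventually {R : Type u} [CommRing R] {F : Type v}
    [AddCommGroup F] [Module R F] (hF : IsPureInjective R F) {κ : Type (max u v)}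
    (l : Filter κ) [l.NeBot] (y v : κ → F) (c : κ → R)
    (h : ∀ i, ∀ᶠ k in l, ∃ w, y k - v i = c i • w) :
    ∃ x, ∀ i, ∃ w, x - v i = c i • w := by
  let E : Submodule R (κ → ULift.{u} F) :=
    { carrier := {f | ∀ᶠ k in l, f k = 0}
      add_mem' := fun {f g} hf hg => by
        filter_upwards [hf, hg] with k hk hk'
        simp [hk, hk']
      zero_mem' := by simp
      smul_mem' := fun a f hf => by
        filter_upwards [hf] with k hk
        simp [hk] }
  let δ : ULift.{u} F →ₗ[R] (κ → ULift.{u} F) := LinearMap.pi fun _ => LinearMap.id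
  let f : ULift.{u} F →ₗ[R] (κ → ULift.{u} F) ⧸ E := E.mkQ ∘ₗ δ
  have hf : Function.Injective f := by
    rw [injective_iff_map_eq_zero]
    intro m hm
    obtain ⟨k, hk⟩ := (show ∀ᶠ k in l, δ m k = 0 from (Submodule.Quotient.mk_eq_zero E).1 hm).exists
    exact hk
  have hpure : f.IsPure := by
    intro L _ _
    rw [injective_iff_map_eq_zero]
    intro ξ hξ
    have hex := rTensor_exact L (LinearMap.exact_subtype_mkQ E) E.mkQ_surjective
    rw [LinearMap.rTensor_comp, LinearMap.comp_apply] at hξ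
    obtain ⟨η, hη⟩ := (hex _).1 hξ
    have hev : ∀ η : TensorProduct R E L, ∀ᶠ k in l,
        LinearMap.rTensor L (LinearMap.proj (R := R) (φ := fun _ : κ => ULift.{u} F) k)
          (LinearMap.rTensor L E.subtype η) = 0 := by
      intro η
      induction η with
      | zero => simp
      | tmul g m =>
        filter_upwards [show ∀ᶠ k in l, g.1 k = 0 from g.2] with k hk
        simp [hk]
      | add η₁ η₂ h₁ h₂ =>
        filter_upwards [h₁, h₂] with k hk₁ hk₂
        rw [map_add, map_add, hk₁, hk₂, add_zero]
    obtain ⟨k, hk⟩ := (hev η).exists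
    rw [hη, ← LinearMap.comp_apply, ← LinearMap.rTensor_comp] at hk
    have : LinearMap.proj (R := R) (φ := fun _ : κ => ULift.{u} F) k ∘ₗ δ = LinearMap.id := rfl
    rwa [this, LinearMap.rTensor_id, LinearMap.id_apply] at hk
  obtain ⟨ρ, hρ⟩ := hF f hf hpure (ULift.moduleEquiv (R := R)).toLinearMap
  refine ⟨ρ (E.mkQ fun k => ⟨y k⟩), fun i => ?_⟩
  have hw : ∃ w : κ → F, ∀ᶠ k in l, y k - v i = c i • w k := by
    choose w hw using fun k => show ∃ w, (∃ w, y k - v i = c i • w) → y k - v i = c i • w by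
      by_cases hk : ∃ w, y k - v i = c i • w
      · exact ⟨hk.choose, fun _ => hk.choose_spec⟩
      · exact ⟨0, fun hk' => absurd hk' hk⟩
    exact ⟨w, (h i).mono hw⟩
  obtain ⟨w, hw⟩ := hw
  refine ⟨ρ (E.mkQ fun k => ⟨w k⟩), ?_⟩
  have hv : v i = ρ (E.mkQ (δ ⟨v i⟩)) := (LinearMap.congr_fun hρ ⟨v i⟩).symm
  rw [hv, ← map_sub, ← map_sub, ← map_smul, ← map_smul]
  congr 1
  refine (Submodule.Quotient.eq E).2 ?_
  change ∀ᶠ k in l, _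
  filter_upwards [hw] with k hk
  exact ULift.ext _ _ (show (y k - v i) - c i • w k = 0 by rw [hk, sub_self])

section

variable {R : Type*} [CommRing R] {M : Type*} [AddCommGroup M] [Module R M]

lemma Ideal.exists_eq_smul_of_mem_smul_top (hR : ∀ a b : R, a ∣ b ∨ b ∣ a) {I : Ideal R} {m : M}
    (hm : m ∈ I • (⊤ : Submodule R M)) : ∃ d ∈ I, ∃ w : M, m = d • w := by
  refine Submodule.smul_induction_on hm (fun r hr n _ => ⟨r, hr, n, rfl⟩) ?_
  · rintro _ _ ⟨d, hd, w, rfl⟩ ⟨e, he, w', rfl⟩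
    rcases hR d e with ⟨t, rfl⟩ | ⟨t, rfl⟩
    · exact ⟨d, hd, w + t • w', by rw [smul_add, mul_smul]⟩
    · exact ⟨e, he, t • w + w', by rw [smul_add, mul_smul]⟩

lemma Module.Flat.exists_eq_smul_of_smul_eq_zero (hR : ∀ a b : R, a ∣ b ∨ b ∣ a) [Module.Flat R M]
    {t : R} {m : M} (h : t • m = 0) : ∃ b, t * b = 0 ∧ ∃ w : M, m = b • w := by
  obtain ⟨k, a, y, hy, ha⟩ := Module.Flat.isTrivialRelation_of_sum_smul_eq_zero
    (R := R) (M := M) (ι := Unit) (f := fun _ => t) (x := fun _ => m) (by simpa using h)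
  refine Ideal.exists_eq_smul_of_mem_smul_top hR
    (I := LinearMap.ker (LinearMap.lsmul R R t)) ?_
  rw [show m = ∑ j, a () j • y j from hy ()]
  exact sum_mem fun j _ => Submodule.smul_mem_smul
    (show t * a () j = 0 by simpa using ha j) trivial

/-- In a flat module the submodule `divColon` is generated by an ideal. -/
lemma mem_divColon_iff_exists (hR : ∀ a b : R, a ∣ b ∨ b ∣ a) [Module.Flat R M] {r c : R} {m : M} :
    m ∈ divColon M r c ↔ ∃ d ∈ divColon R r c, ∃ w : M, m = d • w := by
  constructor
  · intro hm
    obtain ⟨w, hw⟩ := mem_divColon.1 hm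
    obtain ⟨b, hb, w', hw'⟩ := Module.Flat.exists_eq_smul_of_smul_eq_zero hR
      (t := r) (m := m - c • w) (by rw [smul_sub, ← mul_smul, hw, sub_self])
    rw [sub_eq_iff_eq_add] at hw'
    have hc : c ∈ divColon R r c := by simpa using smul_mem_divColon (M := R) r c 1
    have hb : b ∈ divColon R r c := mem_divColon_of_smul_eq_zero hb
    rcases hR b c with ⟨t, rfl⟩ | ⟨t, rfl⟩
    · exact ⟨b, hb, w' + t • w, by rw [hw', smul_add, mul_smul]⟩
    · exact ⟨c, hc, t • w' + w, by rw [hw', smul_add, mul_smul]⟩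
  · rintro ⟨d, hd, w, rfl⟩
    obtain ⟨e, he⟩ := mem_divColon.1 hd
    refine mem_divColon.2 ⟨e • w, ?_⟩
    rw [← mul_smul, ← mul_smul]
    exact congrArg (· • w) he

lemma divColon_le_total (hR : ∀ a b : R, a ∣ b ∨ b ∣ a) [Module.Flat R M] (r₁ c₁ r₂ c₂ : R) :
    divColon M r₁ c₁ ≤ divColon M r₂ c₂ ∨ divColon M r₂ c₂ ≤ divColon M r₁ c₁ := by
  have key : divColon R r₁ c₁ ≤ divColon R r₂ c₂ ∨ divColon R r₂ c₂ ≤ divColon R r₁ c₁ := by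
    by_contra! h
    obtain ⟨d, hd, hd'⟩ := SetLike.not_le_iff_exists.1 h.1
    obtain ⟨e, he, he'⟩ := SetLike.not_le_iff_exists.1 h.2
    rcases hR d e with h | h
    · exact he' (Ideal.mem_of_dvd _ h hd)
    · exact hd' (Ideal.mem_of_dvd _ h he)
  refine key.imp ?_ ?_ <;>
  · intro hle m hm
    obtain ⟨d, hd, w, hw⟩ := (mem_divColon_iff_exists hR).1 hm
    exact (mem_divColon_iff_exists hR).2 ⟨d, hle hd, w, hw⟩

variable {F : Type*} [AddCommGroup F] [Module R F]

lemma smul_surjective_of_notMem (J : Ideal R) [J.IsPrime] (φ : F →ₗ[R] M)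
    [IsLocalizedModule J.primeCompl φ] {d : R} (hd : d ∉ J) (m : M) : ∃ w : M, m = d • w := by
  obtain ⟨w, hw⟩ := ((Module.End.isUnit_iff _).1
    (IsLocalizedModule.map_units φ (⟨d, hd⟩ : J.primeCompl))).2 m
  exact ⟨w, hw.symm⟩

/-- If the submodule `divColon` of the localization is proper, it consists of images of elements of
the original module. -/
lemma divColon_le_range (hR : ∀ a b : R, a ∣ b ∨ b ∣ a) [Module.Flat R M]
    (J : Ideal R) [J.IsPrime] (φ : F →ₗ[R] M) [IsLocalizedModule J.primeCompl φ] {r c : R}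
    (h : divColon M r c ≠ ⊤) :
    divColon M r c ≤ LinearMap.range φ := by
  intro m hm
  obtain ⟨d, hd, w, rfl⟩ := (mem_divColon_iff_exists hR).1 hm
  have hdJ : d ∈ J := by
    by_contra hdJ
    refine h (eq_top_iff.2 fun m _ => (mem_divColon_iff_exists hR).2 ⟨d, hd, ?_⟩)
    exact smul_surjective_of_notMem J φ hdJ m
  obtain ⟨⟨y, s⟩, hs⟩ := IsLocalizedModule.surj J.primeCompl φ w
  have hs : (s : R) • w = φ y := hs
  rcases hR s d with ⟨e, rfl⟩ | h
  · exact ⟨e • y, by rw [map_smul, ← hs, ← mul_smul, mul_comm]⟩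
  · exact absurd (Ideal.mem_of_dvd _ h hdJ) s.2

/-- Between two distinct submodules `divColon` of the localization there is a principal multiple,
already before localizing. -/
lemma exists_smul_between (hR : ∀ a b : R, a ∣ b ∨ b ∣ a) [Module.Flat R F] [Module.Flat R M]
    (J : Ideal R) [J.IsPrime] (φ : F →ₗ[R] M) [IsLocalizedModule J.primeCompl φ] {r₁ c₁ r₂ c₂ : R}
    (h : divColon M r₁ c₁ < divColon M r₂ c₂) :
    ∃ c : R, (∀ w : M, c • w ∈ divColon M r₂ c₂) ∧
      ∀ y : F, φ y ∈ divColon M r₁ c₁ → ∃ w, y = c • w := by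
  obtain ⟨m, hm, hm'⟩ := SetLike.exists_of_lt h
  obtain ⟨c, hc, w₀, rfl⟩ := (mem_divColon_iff_exists hR).1 hm
  refine ⟨c, fun w => (mem_divColon_iff_exists hR).2 ⟨c, hc, w, rfl⟩, fun y hy => ?_⟩
  obtain ⟨d, hd, x, hx⟩ := (mem_divColon_iff_exists hR).1 hy
  obtain ⟨⟨z, s⟩, hs⟩ := IsLocalizedModule.surj J.primeCompl φ x
  have hs : (s : R) • x = φ z := hs
  obtain ⟨w₁, rfl⟩ := smul_surjective_of_notMem J φ s.2 w₀
  rcases hR d (s * c) with ⟨e, he⟩ | ⟨e, rfl⟩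
  · refine absurd ?_ hm'
    rw [← mul_smul, mul_comm, he, mul_smul]
    exact (mem_divColon_iff_exists hR).2 ⟨d, hd, _, rfl⟩
  have hφ : φ y = φ ((c * e) • z) := by
    rw [hx, map_smul, ← hs, ← mul_smul]
    congr 1
    ring
  obtain ⟨t, ht⟩ := (IsLocalizedModule.eq_iff_exists J.primeCompl φ).1 hφ
  have ht : (t : R) • (y - (c * e) • z) = 0 := by
    rw [smul_sub, sub_eq_zero]
    exact ht
  obtain ⟨b, hb, w, hw⟩ := Module.Flat.exists_eq_smul_of_smul_eq_zero hR ht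
  rw [sub_eq_iff_eq_add] at hw
  rcases hR c b with ⟨f, rfl⟩ | ⟨f, rfl⟩
  · exact ⟨f • w + e • z, by rw [hw, smul_add, mul_smul, mul_smul]⟩
  · refine absurd ?_ hm'
    obtain ⟨w₂, hw₂⟩ := smul_surjective_of_notMem J φ t.2 ((s : R) • w₁)
    rw [hw₂, ← mul_smul, show b * f * (t : R) = (t * b) * f by ring, hb, zero_mul, zero_smul]
    exact zero_mem _

end

/-- Over a ring whose divisibility relation is total, pairwise compatible systems of congruences
are solvable in the localization at a prime of a flat pure-injective module. -/
lemma IsPureInjective.solvable_of_isLocalizedModule {R : Type u} [CommRing R]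
    (hR : ∀ a b : R, a ∣ b ∨ b ∣ a) {F : Type v} [AddCommGroup F] [Module R F] [Module.Flat R F]
    (hF : IsPureInjective R F) (J : Ideal R) [J.IsPrime] {M : Type*} [AddCommGroup M] [Module R M]
    [Module.Flat R M] (φ : F →ₗ[R] M) [IsLocalizedModule J.primeCompl φ] {ι : Type (max u v)}
    (r c : ι → R) (z : ι → M)
    (hz : ∀ i j, z i - z j ∈ divColon M (r i) (c i) ⊔ divColon M (r j) (c j)) :
    ∃ y, ∀ i, y - z i ∈ divColon M (r i) (c i) := by
  let G : ι → Submodule R M := fun i => divColon M (r i) (c i)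
  have htot : ∀ i j, G i ≤ G j ∨ G j ≤ G i := fun i j => divColon_le_total hR _ _ _ _
  have hzle : ∀ {i j}, G i ≤ G j → z i - z j ∈ G j := fun {i j} hij => by
    have h : z i - z j ∈ G i ⊔ G j := hz i j
    rwa [sup_eq_right.2 hij] at h
  by_cases hmin : ∃ i₀, ∀ i, G i₀ ≤ G i
  · obtain ⟨i₀, hi₀⟩ := hmin
    exact ⟨z i₀, fun i => hzle (hi₀ i)⟩
  push Not at hmin
  have hlt : ∀ i, ∃ j, G j < G i := fun i => by
    obtain ⟨j, hj⟩ := hmin i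
    exact ⟨j, lt_of_le_not_ge ((htot i j).resolve_left hj) hj⟩
  rcases isEmpty_or_nonempty ι with hι | ⟨⟨i₁⟩⟩
  · exact ⟨0, fun i => isEmptyElim i⟩
  obtain ⟨i₀, hi₀⟩ := hlt i₁
  have hrange : G i₀ ≤ LinearMap.range φ :=
    divColon_le_range hR J φ (hi₀.trans_le le_top).ne
  let κ := {i : ι // G i ≤ G i₀}
  choose y hy using fun k : κ => hrange (hzle k.2)
  have hlt' : ∀ k : κ, ∃ j : κ, G j < G k := fun k => by
    obtain ⟨j, hj⟩ := hlt k
    exact ⟨⟨j, hj.le.trans k.2⟩, hj⟩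
  choose j hj using hlt'
  choose a ha ha' using fun k : κ => exists_smul_between hR J φ (hj k)
  let _ : Preorder κ := Preorder.lift fun k : κ => OrderDual.toDual (G k)
  have hle : ∀ k k' : κ, k ≤ k' ↔ G k' ≤ G k := fun k k' => Iff.rfl
  have : IsDirectedOrder κ := ⟨fun k k' => (htot k k').elim
    (fun h => ⟨k, le_refl _, (hle _ _).2 h⟩) (fun h => ⟨k', (hle _ _).2 h, le_refl _⟩)⟩
  have : Nonempty κ := ⟨⟨i₀, le_rfl⟩⟩
  obtain ⟨x, hx⟩ := hF.exists_of_eventually Filter.atTop y (fun k => y (j k)) a (fun k => by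
    filter_upwards [Filter.eventually_ge_atTop (j k)] with k' hk'
    refine ha' k _ ?_
    rw [map_sub, hy, hy, sub_sub_sub_cancel_right]
    exact hzle ((hle _ _).1 hk'))
  have hsol : ∀ k : κ, φ x + z i₀ - z k ∈ G k := fun k => by
    obtain ⟨w, hw⟩ := hx k
    have h1 : φ x + z i₀ - z k = a k • φ w + (z (j k) - z k) := by
      rw [← map_smul, ← hw, map_sub, hy]
      abel
    rw [h1]
    exact add_mem (ha k _) (hzle (hj k).le)
  refine ⟨φ x + z i₀, fun i => ?_⟩
  rcases htot i i₀ with h | h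
  · exact hsol ⟨i, h⟩
  · rw [← sub_add_sub_cancel _ (z i₀)]
    exact add_mem (h (hsol ⟨i₀, le_rfl⟩)) (hzle h)

/-- Let `R` be a valuation ring, `F` a flat pure-injective `R`-module and
`J` a prime ideal of `R`.  Then the localization `F_J` is a pure-injective `R`-module. -/
theorem pureInjective_localizedModule {R : Type u} [CommRing R]
    (hchain : ∀ a b : R, ∃ c : R, a * c = b ∨ b * c = a)
    {F : Type v} [AddCommGroup F] [Module R F] (hflat : Module.Flat R F)
    (hF : IsPureInjective R F) (J : Ideal R) (hJ : J.IsPrime) :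
    IsPureInjective R (LocalizedModule J.primeCompl F) := by
  have hR : ∀ a b : R, a ∣ b ∨ b ∣ a := fun a b => by
    obtain ⟨c, h | h⟩ := hchain a b
    · exact .inl ⟨c, h.symm⟩
    · exact .inr ⟨c, h.symm⟩
  have : Module.Flat R (LocalizedModule J.primeCompl F) :=
    haveI := IsLocalization.flat (Localization J.primeCompl) J.primeCompl
    Module.Flat.trans R (Localization J.primeCompl) _
  exact isPureInjective_of_solvable hR fun ι r c z hz =>
    hF.solvable_of_isLocalizedModule hR J (LocalizedModule.mkLinearMap J.primeCompl F) r c z hz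
end

section
/- Let $R$ be a valuation ring, let $Z$ be the set of zerodivisors of $R$, let $J$ be a prime ideal of $R$ with $Z \subseteq J$, and let $E$ be an injective $R$-module. Set $F = \{x \in E \mid J \subsetneq (0 : x)\}$. Then $F$ is an $R$-submodule of $E$, for every $s \in R \setminus J$ multiplication by $s$ on $E/F$ is bijective, and the natural map $E \to E_J$ induces an isomorphism $E/F \cong E_J$. -/
/-- Over a commutative ring whose elements are totally ordered by divisibility, an injective module
is divisible by every regular element, at least at the points not killed by it. There is no
restriction on the universes of the ring and the module. -/
theorem exists_smul_eq_of_injective_of_total {R : Type*} [CommRing R]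
    (hchain : ∀ a b : R, ∃ c : R, a * c = b ∨ b * c = a)
    {E : Type*} [AddCommGroup E] [Module R E] (hE : Module.Injective R E)
    {s : R} (hs : ∀ r : R, s * r = 0 → r = 0) {x : E} (hsx : s • x ≠ 0) :
    ∃ y : E, s • y = x := by
  set I : Ideal R := Ideal.torsionOf R E x with hI
  have hdvd : ∀ r ∈ I, ∃ t, s * t = r := by
    intro r hr
    rw [hI, Ideal.mem_torsionOf_iff] at hr
    obtain ⟨c, h | h⟩ := hchain s r
    · exact ⟨c, h⟩
    · refine absurd ?_ hsx
      rw [← h, mul_comm, mul_smul, hr, smul_zero]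
  set K : Ideal R := Submodule.map (LinearMap.lsmul R R s) I
  have hsmall : Small.{_} (R ⧸ K) := by
    have hrep : ∀ a : E, ∃ r : R, ∀ t : R, t • x = a → t - r ∈ I := by
      intro a
      by_cases ha : ∃ r : R, r • x = a
      · obtain ⟨r, hr⟩ := ha
        refine ⟨r, fun t ht => ?_⟩
        rw [hI, Ideal.mem_torsionOf_iff, sub_smul, hr, ht, sub_self]
      · exact ⟨0, fun t ht => absurd ⟨t, ht⟩ ha⟩
    choose σ hσ using hrep
    refine small_of_surjective
      (f := fun p : E × E => (Ideal.Quotient.mk K (σ p.1 + s * σ p.2))) ?_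
    intro q
    obtain ⟨r, rfl⟩ := Ideal.Quotient.mk_surjective q
    obtain ⟨t, ht⟩ := hdvd _ (hσ (r • x) r rfl)
    refine ⟨(r • x, t • x), ?_⟩
    refine (Ideal.Quotient.eq.2 ?_).symm
    refine ⟨t - σ (t • x), hσ _ t rfl, ?_⟩
    simp only [LinearMap.lsmul_apply, smul_eq_mul]
    linear_combination ht
  let m : (R ⧸ I) →ₗ[R] (R ⧸ K) :=
    Submodule.mapQ I K (LinearMap.lsmul R R s) (Submodule.le_comap_map _ _)
  have hm : Function.Injective m := by
    rw [← LinearMap.ker_eq_bot, LinearMap.ker_eq_bot']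
    intro q hq
    obtain ⟨r, rfl⟩ := Submodule.Quotient.mk_surjective _ q
    obtain ⟨i, hi, h⟩ := (Submodule.Quotient.mk_eq_zero K).1 hq
    have : r = i := sub_eq_zero.1 <| hs _ <| by
      simp only [LinearMap.lsmul_apply, smul_eq_mul] at h
      linear_combination -h
    exact (Submodule.Quotient.mk_eq_zero I).2 (this ▸ hi)
  let u := Ideal.quotTorsionOfEquivSpanSingleton R E x
  let v := Shrink.linearEquiv R (R ⧸ K)
  obtain ⟨h, hh⟩ := hE.out (v.symm.toLinearMap ∘ₗ m ∘ₗ u.symm.toLinearMap)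
    (v.symm.injective.comp (hm.comp u.symm.injective)) (Submodule.span R {x}).subtype
  refine ⟨h (v.symm (Submodule.Quotient.mk 1)), ?_⟩
  have key := hh (u (Submodule.Quotient.mk 1))
  have hu : ((u (Submodule.Quotient.mk 1) : Submodule.span R {x}) : E) = x := by
    exact (congrArg Subtype.val
      (Ideal.quotTorsionOfEquivSpanSingleton_apply_mk (M := E) x (1 : R))).trans (one_smul R x)
  have hm1 : m (Submodule.Quotient.mk 1) = s • Submodule.Quotient.mk 1 := rfl
  rw [Submodule.subtype_apply, hu, LinearMap.comp_apply, LinearMap.comp_apply,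
    LinearEquiv.coe_coe, LinearEquiv.coe_coe, u.symm_apply_apply, hm1, map_smul, map_smul] at key
  exact key


/-- Let `R` be a valuation ring, `Z` its (prime) ideal of zerodivisors,
`J` a prime ideal with `Z ⊆ J` and `E` an injective `R`-module.  Set
`F = {x ∈ E | J ⊊ (0 : x)}`.  Then `F` is an `R`-submodule of `E`, multiplication by any
`s ∈ R ∖ J` on `E/F` is bijective, and the natural map `E → E_J` induces an isomorphism
`E/F ≅ E_J`. -/
theorem quotient_iso_localizedModule_of_injective {R : Type*} [CommRing R]
    (hchain : ∀ a b : R, ∃ c : R, a * c = b ∨ b * c = a)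
    (Z : Ideal R) (hZ : ∀ r : R, r ∈ Z ↔ ∃ s : R, s ≠ 0 ∧ r * s = 0)
    (J : Ideal R) (hJ : J.IsPrime) (hZJ : Z ≤ J)
    {E : Type*} [AddCommGroup E] [Module R E] (hE : Module.Injective R E) :
    ∃ F : Submodule R E,
      (∀ x : E, x ∈ F ↔ J < (Submodule.span R {x}).annihilator) ∧
      (∀ s : R, s ∉ J → Function.Bijective fun y : E ⧸ F => s • y) ∧
      ∃ e : (E ⧸ F) ≃ₗ[R] LocalizedModule J.primeCompl E,
        ∀ x : E, e (Submodule.Quotient.mk x) = LocalizedModule.mk x 1 := by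
  have hann : ∀ x : E, J < (Submodule.span R {x}).annihilator ↔ ∃ s, s ∉ J ∧ s • x = 0 := by
    intro x
    constructor
    · intro h
      obtain ⟨s, hs, hsJ⟩ := SetLike.exists_of_lt h
      exact ⟨s, hsJ, (Submodule.mem_annihilator_span_singleton x s).1 hs⟩
    · rintro ⟨s, hsJ, hs⟩
      refine SetLike.lt_iff_le_and_exists.2
        ⟨fun j hj => ?_, s, (Submodule.mem_annihilator_span_singleton x s).2 hs, hsJ⟩
      refine (Submodule.mem_annihilator_span_singleton x j).2 ?_
      obtain ⟨c, h | h⟩ := hchain s j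
      · rw [← h, mul_comm, mul_smul, hs, smul_zero]
      · exact absurd (h ▸ J.mul_mem_right c hj) hsJ
  have hmul : ∀ {s t : R}, s ∉ J → t ∉ J → s * t ∉ J := fun hs ht => J.primeCompl.mul_mem hs ht
  let F : Submodule R E :=
    { carrier := {x | ∃ s, s ∉ J ∧ s • x = 0}
      zero_mem' := ⟨1, J.primeCompl.one_mem, smul_zero _⟩
      add_mem' := by
        rintro x y ⟨s, hs, hx⟩ ⟨t, ht, hy⟩
        refine ⟨s * t, hmul hs ht, ?_⟩
        rw [smul_add, mul_smul s t y, hy, mul_comm, mul_smul, hx, smul_zero, smul_zero, add_zero]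
      smul_mem' := by
        rintro c x ⟨s, hs, hx⟩
        exact ⟨s, hs, by rw [smul_comm, hx, smul_zero]⟩ }
  have hF : ∀ x, x ∈ F ↔ ∃ s, s ∉ J ∧ s • x = 0 := fun _ => Iff.rfl
  have hbij : ∀ s : R, s ∉ J → Function.Bijective fun y : E ⧸ F => s • y := by
    intro s hs
    constructor
    · intro a b hab
      obtain ⟨x, rfl⟩ := Submodule.Quotient.mk_surjective _ a
      obtain ⟨y, rfl⟩ := Submodule.Quotient.mk_surjective _ b
      obtain ⟨t, ht, h⟩ := (hF _).1 ((Submodule.Quotient.eq F).1 hab)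
      refine (Submodule.Quotient.eq F).2 ⟨t * s, hmul ht hs, ?_⟩
      rw [mul_smul, smul_sub, h]
    · intro a
      obtain ⟨x, rfl⟩ := Submodule.Quotient.mk_surjective _ a
      by_cases hsx : s • x = 0
      · refine ⟨0, ?_⟩
        simpa using ((Submodule.Quotient.mk_eq_zero F).2 ⟨s, hs, hsx⟩).symm
      · have hreg : ∀ r : R, s * r = 0 → r = 0 := fun r hr => by
          by_contra hr0
          exact hs (hZJ ((hZ s).2 ⟨r, hr0, hr⟩))
        obtain ⟨y, rfl⟩ := exists_smul_eq_of_injective_of_total hchain hE hreg hsx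
        exact ⟨Submodule.Quotient.mk y, rfl⟩
  have hloc : IsLocalizedModule J.primeCompl F.mkQ :=
    { map_units := fun s => (Module.End.isUnit_iff _).2 (hbij s s.2)
      surj := fun y => by
        obtain ⟨x, rfl⟩ := Submodule.Quotient.mk_surjective _ y
        exact ⟨(x, 1), one_smul _ _⟩
      exists_of_eq := fun {x y} h => by
        obtain ⟨s, hs, hxy⟩ := (hF _).1 ((Submodule.Quotient.eq F).1 h)
        exact ⟨⟨s, hs⟩, sub_eq_zero.1 ((smul_sub s x y).symm.trans hxy)⟩ }
  refine ⟨F, fun x => (hF x).trans (hann x).symm, hbij,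
    (IsLocalizedModule.iso J.primeCompl F.mkQ).symm, fun x => ?_⟩
  exact IsLocalizedModule.iso_symm_apply' J.primeCompl F.mkQ _ x 1 (one_smul _ _)
end

section
/- Let $R$ be an h-local Prüfer domain and let $S$ be a multiplicative subset of $R$ with $0 \notin S$. Then $S^{-1}R$ is an h-local Prüfer domain. -/
/-- A Prüfer domain: the localization at every maximal ideal is a valuation ring
(its ideals are totally ordered, equivalently elements are pairwise divisible). -/
def IsPruferRing (R : Type*) [CommRing R] : Prop :=
  ∀ (P : Ideal R) (_hP : P.IsMaximal),
    ∀ a b : Localization.AtPrime P, ∃ c : Localization.AtPrime P, a * c = b ∨ b * c = a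

/-- An h-local ring: `R ⧸ I` is semilocal (finitely many maximal ideals) for every nonzero
ideal `I` and `R ⧸ P` is local for every nonzero prime ideal `P`. -/
def IsHLocal (R : Type*) [CommRing R] : Prop :=
  (∀ I : Ideal R, I ≠ ⊥ → {M : Ideal (R ⧸ I) | M.IsMaximal}.Finite) ∧
    ∀ P : Ideal R, P.IsPrime → P ≠ ⊥ → IsLocalRing (R ⧸ P)

theorem IsPruferRing.exists_mul_eq_mul {R : Type*} [CommRing R] [IsDomain R]
    (h : IsPruferRing R) (N : Ideal R) [hN : N.IsMaximal] (x y : R) :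
    ∃ r t : R, t ∉ N ∧ (x * r = y * t ∨ y * r = x * t) := by
  have cancel (u v : R) (c : Localization.AtPrime N)
      (hc : algebraMap R _ u * c = algebraMap R _ v) : ∃ r t : R, t ∉ N ∧ u * r = v * t := by
    obtain ⟨⟨r, t⟩, hrt⟩ := IsLocalization.surj N.primeCompl c
    refine ⟨r, t, t.2, IsLocalization.injective (Localization.AtPrime N)
      N.primeCompl_le_nonZeroDivisors ?_⟩
    rw [map_mul, map_mul, ← hrt, ← hc, mul_assoc]
  obtain ⟨c, hc | hc⟩ := h N hN (algebraMap R _ x) (algebraMap R _ y)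
  · obtain ⟨r, t, ht, e⟩ := cancel x y c hc
    exact ⟨r, t, ht, .inl e⟩
  · obtain ⟨r, t, ht, e⟩ := cancel y x c hc
    exact ⟨r, t, ht, .inr e⟩

/-- The primes of a Prüfer domain below a given maximal ideal form a chain. -/
theorem IsPruferRing.le_or_le_of_le_isMaximal {R : Type*} [CommRing R] [IsDomain R]
    (h : IsPruferRing R) {P Q N : Ideal R} [hP : P.IsPrime] [hQ : Q.IsPrime] [N.IsMaximal]
    (hPN : P ≤ N) (hQN : Q ≤ N) : P ≤ Q ∨ Q ≤ P := by
  by_contra! hne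
  obtain ⟨x, hxP, hxQ⟩ := SetLike.not_le_iff_exists.1 hne.1
  obtain ⟨y, hyQ, hyP⟩ := SetLike.not_le_iff_exists.1 hne.2
  obtain ⟨r, t, ht, e | e⟩ := h.exists_mul_eq_mul N x y
  · have hmem : y * t ∈ P := e ▸ P.mul_mem_right r hxP
    exact (hP.mem_or_mem hmem).elim hyP fun h' => ht (hPN h')
  · have hmem : x * t ∈ Q := e ▸ Q.mul_mem_right r hyQ
    exact (hQ.mem_or_mem hmem).elim hxQ fun h' => ht (hQN h')

theorem IsPruferRing.isMaximal_eq_of_comap_le {R : Type*} [CommRing R] [IsDomain R]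
    (h : IsPruferRing R) (S : Submonoid R) {A : Type*} [CommRing A] [Algebra R A]
    [IsLocalization S A] {M M' : Ideal A} [hM : M.IsMaximal] [hM' : M'.IsMaximal]
    {N : Ideal R} [N.IsMaximal] (hMN : M.comap (algebraMap R A) ≤ N)
    (hMN' : M'.comap (algebraMap R A) ≤ N) : M = M' := by
  have comap_le {I J : Ideal A} (hIJ : I.comap (algebraMap R A) ≤ J.comap (algebraMap R A)) :
      I ≤ J := by
    rw [← IsLocalization.map_under S A I, ← IsLocalization.map_under S A J]
    exact Ideal.map_mono hIJ
  rcases h.le_or_le_of_le_isMaximal hMN hMN' with hle | hle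
  · exact hM.eq_of_le hM'.ne_top (comap_le hle)
  · exact (hM'.eq_of_le hM.ne_top (comap_le hle)).symm

theorem IsPruferRing.of_isLocalization {R : Type*} [CommRing R] [IsDomain R]
    (h : IsPruferRing R) (S : Submonoid R) (A : Type*) [CommRing A] [Algebra R A]
    [IsLocalization S A] : IsPruferRing A := by
  intro M hM a b
  have : IsLocalization.AtPrime (Localization.AtPrime M) (M.comap (algebraMap R A)) :=
    IsLocalization.isLocalization_isLocalization_atPrime_isLocalization S _ M
  obtain ⟨N, hN, hMN⟩ := Ideal.exists_le_maximal (M.comap (algebraMap R A))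
    (Ideal.IsPrime.under R M).ne_top
  have dvd (u v r t : R) (ht : t ∉ N) (e : u * r = v * t) :
      algebraMap R (Localization.AtPrime M) u ∣ algebraMap R _ v := by
    have hu : IsUnit (algebraMap R (Localization.AtPrime M) t) :=
      IsLocalization.map_units (M := (M.comap (algebraMap R A)).primeCompl) _
        ⟨t, fun h' => ht (hMN h')⟩
    rw [← hu.dvd_mul_right, ← map_mul, ← e, map_mul]
    exact dvd_mul_right _ _
  obtain ⟨x, y, s, hx, hy⟩ :=
    IsLocalization.surj₂ (M.comap (algebraMap R A)).primeCompl (Localization.AtPrime M) a b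
  have hs := IsLocalization.map_units (Localization.AtPrime M) s
  have hab : a ∣ b ∨ b ∣ a := by
    obtain ⟨r, t, ht, e | e⟩ := h.exists_mul_eq_mul N x y
    · left
      rw [← hs.dvd_mul_right, ← hs.mul_right_dvd, hx, hy]
      exact dvd x y r t ht e
    · right
      rw [← hs.dvd_mul_right, ← hs.mul_right_dvd, hx, hy]
      exact dvd y x r t ht e
  obtain ⟨c, hc⟩ | ⟨c, hc⟩ := hab
  · exact ⟨c, .inl hc.symm⟩
  · exact ⟨c, .inr hc.symm⟩

theorem Ideal.finite_setOf_isMaximal_quotient_iff {R : Type*} [CommRing R] (I : Ideal R) :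
    {M : Ideal (R ⧸ I) | M.IsMaximal}.Finite ↔ {M : Ideal R | M.IsMaximal ∧ I ≤ M}.Finite := by
  have hsurj := Ideal.Quotient.mk_surjective (I := I)
  have himage : Ideal.comap (Ideal.Quotient.mk I) '' {M | M.IsMaximal} =
      {M : Ideal R | M.IsMaximal ∧ I ≤ M} := by
    ext M
    constructor
    · rintro ⟨M, hM : M.IsMaximal, rfl⟩
      refine ⟨Ideal.comap_isMaximal_of_surjective _ hsurj, ?_⟩
      simpa using Ideal.ker_le_comap (K := M) (Ideal.Quotient.mk I)
    · rintro ⟨hM, hIM⟩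
      refine ⟨M.map (Ideal.Quotient.mk I), Ideal.IsMaximal.map_of_surjective_of_ker_le hsurj
        (by simpa using hIM), Ideal.comap_map_quotientMk _ _ |>.trans (sup_eq_right.2 hIM)⟩
  rw [← himage, Set.finite_image_iff (Ideal.comap_injective_of_surjective _ hsurj).injOn]

theorem Ideal.isLocalRing_quotient_iff {R : Type*} [CommRing R] {I : Ideal R} (hI : I ≠ ⊤) :
    IsLocalRing (R ⧸ I) ↔
      ∀ M M' : Ideal R, M.IsMaximal → M'.IsMaximal → I ≤ M → I ≤ M' → M = M' := by
  have hsurj := Ideal.Quotient.mk_surjective (I := I)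
  have : Nontrivial (R ⧸ I) := Ideal.Quotient.nontrivial_iff.2 hI
  constructor
  · intro _ M M' hM hM' hIM hIM'
    have comap_eq (K : Ideal R) (hK : K.IsMaximal) (hIK : I ≤ K) :
        K = (IsLocalRing.maximalIdeal (R ⧸ I)).comap (Ideal.Quotient.mk I) := by
      rw [← IsLocalRing.eq_maximalIdeal (Ideal.IsMaximal.map_of_surjective_of_ker_le hsurj
        (by simpa using hIK)), Ideal.comap_map_quotientMk, sup_eq_right.2 hIK]
    rw [comap_eq M hM hIM, comap_eq M' hM' hIM']
  · intro h
    obtain ⟨M, hM⟩ := Ideal.exists_maximal (R ⧸ I)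
    have le_comap (K : Ideal (R ⧸ I)) : I ≤ K.comap (Ideal.Quotient.mk I) := by
      simpa using Ideal.ker_le_comap (K := K) (Ideal.Quotient.mk I)
    refine IsLocalRing.of_unique_max_ideal ⟨M, hM, fun M' (hM' : M'.IsMaximal) => ?_⟩
    exact Ideal.comap_injective_of_surjective _ hsurj
      (h _ _ (Ideal.comap_isMaximal_of_surjective _ hsurj)
        (Ideal.comap_isMaximal_of_surjective _ hsurj) (le_comap M') (le_comap M))

theorem IsHLocal.of_isLocalization {R : Type*} [CommRing R] [IsDomain R]
    (hprufer : IsPruferRing R) (h : IsHLocal R) (S : Submonoid R) (A : Type*) [CommRing A]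
    [Algebra R A] [IsLocalization S A] : IsHLocal A := by
  have comap_ne_bot {I : Ideal A} (hI : I ≠ ⊥) : I.comap (algebraMap R A) ≠ ⊥ := by
    intro h0
    apply hI
    rw [← IsLocalization.map_under S A I, Ideal.under_def, h0, Ideal.map_bot]
  have exists_max (M : Ideal A) (hM : M.IsMaximal) :
      ∃ N : Ideal R, N.IsMaximal ∧ M.comap (algebraMap R A) ≤ N :=
    Ideal.exists_le_maximal _ (Ideal.IsPrime.under R M).ne_top
  refine ⟨fun I hI => ?_, fun P hP hP0 => ?_⟩
  · rw [Ideal.finite_setOf_isMaximal_quotient_iff]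
    choose! g hg using exists_max
    refine Set.Finite.of_injOn (f := g) (fun M hM => ?_) (fun M hM M' hM' e => ?_)
      ((Ideal.finite_setOf_isMaximal_quotient_iff _).1 (h.1 _ (comap_ne_bot hI)))
    · exact ⟨(hg M hM.1).1, (Ideal.comap_mono hM.2).trans (hg M hM.1).2⟩
    · have := hM.1
      have := hM'.1
      have := (hg M hM.1).1
      exact hprufer.isMaximal_eq_of_comap_le S (hg M hM.1).2 (e ▸ (hg M' hM'.1).2)
  · have hprime := Ideal.IsPrime.under R P
    rw [Ideal.isLocalRing_quotient_iff hP.ne_top]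
    intro M M' hM hM' hPM hPM'
    obtain ⟨N, hN, hMN⟩ := exists_max M hM
    obtain ⟨N', hN', hMN'⟩ := exists_max M' hM'
    obtain rfl : N = N' := (Ideal.isLocalRing_quotient_iff hprime.ne_top).1
      (h.2 _ hprime (comap_ne_bot hP0)) N N' hN hN' ((Ideal.comap_mono hPM).trans hMN)
      ((Ideal.comap_mono hPM').trans hMN')
    exact hprufer.isMaximal_eq_of_comap_le S hMN hMN'

/-- Let `R` be an h-local Prüfer domain and `S` a multiplicative subset of
`R` with `0 ∉ S`.  Then `S⁻¹R` is an h-local Prüfer domain. -/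
theorem localization_hLocal_prufer {R : Type*} [CommRing R] [IsDomain R]
    (hprufer : IsPruferRing R) (hhlocal : IsHLocal R)
    (S : Submonoid R) (hS : (0 : R) ∉ S) :
    IsDomain (Localization S) ∧ IsPruferRing (Localization S) ∧
      IsHLocal (Localization S) := by
  exact ⟨IsLocalization.isDomain_localization (le_nonZeroDivisors_of_noZeroDivisors hS),
    hprufer.of_isLocalization S _, IsHLocal.of_isLocalization hprufer hhlocal S _⟩
end

section
/- Let $K$ be a field, let $I$ be an infinite set, let $R = K^I$ (the product ring), let $J = K^{(I)}$ (the ideal of elements of $R$ with finite support), and let $S = \{1 - r \mid r \in J\}$. Then $S$ is a multiplicative subset of $R$ and the quotient ring $R/J$ is isomorphic, as an $R$-algebra, to the localization $S^{-1}R$. -/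
/-- The multiplicative subset `1 - J` attached to an ideal `J`. -/
def Ideal.oneSubSubmonoid {R : Type*} [CommRing R] (J : Ideal R) : Submonoid R where
  carrier := {g | ∃ r ∈ J, g = 1 - r}
  one_mem' := ⟨0, J.zero_mem, by simp⟩
  mul_mem' := by
    rintro _ _ ⟨r, hr, rfl⟩ ⟨s, hs, rfl⟩
    exact ⟨r + s - r * s, J.sub_mem (J.add_mem hr hs) (J.mul_mem_right s hr), by ring⟩

/-- If every element of `J` is fixed by multiplication by some element of `J`, then `R ⧸ J` is the
localization of `R` at `1 - J`. -/
theorem Ideal.isLocalization_quotient_oneSubSubmonoid {R : Type*} [CommRing R] (J : Ideal R)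
    (hJ : ∀ r ∈ J, ∃ e ∈ J, e * r = r) : IsLocalization J.oneSubSubmonoid (R ⧸ J) where
  map_units := by
    rintro ⟨_, r, hr, rfl⟩
    simp [Ideal.Quotient.algebraMap_eq, Ideal.Quotient.eq_zero_iff_mem.mpr hr]
  surj z := by
    obtain ⟨x, rfl⟩ := Ideal.Quotient.mk_surjective z
    exact ⟨(x, 1), by simp [Ideal.Quotient.algebraMap_eq]⟩
  exists_of_eq {x y} h := by
    obtain ⟨e, he, hxy⟩ := hJ (x - y) (Ideal.Quotient.eq.mp h)
    exact ⟨⟨1 - e, e, he, rfl⟩, by linear_combination -hxy⟩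

/-- Let `K` be a field, `I` an infinite set, `R = K^I` the product ring,
`J = K^(I)` the ideal of elements of `R` with finite support, and `S = {1 - r | r ∈ J}`.
Then `S` is a multiplicative subset of `R` and the quotient ring `R/J` is isomorphic, as an
`R`-algebra, to the localization `S⁻¹R`. -/
theorem quotient_iso_localization_of_finite_support {K : Type*} [Field K]
    {I : Type*} [Infinite I]
    (J : Ideal (I → K)) (hJ : ∀ f : I → K, f ∈ J ↔ (Function.support f).Finite) :
    ∃ S : Submonoid (I → K),
      (S : Set (I → K)) = {g : I → K | ∃ r ∈ J, g = 1 - r} ∧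
        Nonempty (((I → K) ⧸ J) ≃ₐ[I → K] Localization S) := by
  have := J.isLocalization_quotient_oneSubSubmonoid fun r hr ↦ by
    refine ⟨(Function.support r).indicator 1, (hJ _).mpr ?_, ?_⟩
    · exact ((hJ r).mp hr).subset Set.support_indicator_subset
    · ext i
      by_cases hi : r i = 0 <;> simp [hi]
  exact ⟨J.oneSubSubmonoid, rfl, ⟨IsLocalization.algEquiv J.oneSubSubmonoid _ _⟩⟩
end
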